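/- arXiv:1909.06752 — 6 statements merged into one kernel-verified Lean document; each statement's English description precedes it below -/
import Mathlib

section
/- A class 𝒞 of graphs has bounded expansion if and only if for every r ∈ ℕ there exists a number w = w(r) such that wcol_r(G) ≤ w for every G ∈ 𝒞. -/
open SimpleGraph

variable {V : Type} {W : Type}

/-- The set of vertices at distance at most `r` from `v` in `G`. -/
def ball (G : SimpleGraph V) (r : ℕ) (v : V) : Set V :=
  {u | ∃ p : G.Walk v u, p.length ≤ r}

/-- `G` has radius at most `r`. -/
def hasRadiusLE (G : SimpleGraph V) (r : ℕ) : Prop :=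
  ∃ u : V, ∀ v : V, ∃ p : G.Walk u v, p.length ≤ r

/-- `H` is a depth-`r` minor of `G`: there are pairwise disjoint branch sets of
radius at most `r`, one for each vertex of `H`, connected appropriately. -/
def IsDepthMinor (r : ℕ) (H : SimpleGraph W) (G : SimpleGraph V) : Prop :=
  ∃ φ : W → Set V,
    (∀ w : W, hasRadiusLE (G.induce (φ w)) r) ∧
    (Pairwise fun w w' => Disjoint (φ w) (φ w')) ∧
    (∀ a b : W, H.Adj a b → ∃ u ∈ φ a, ∃ v ∈ φ b, G.Adj u v)

/-- `H` is a minor of `G` (no restriction on the radius of branch sets). -/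
def IsMinorOf (H : SimpleGraph W) (G : SimpleGraph V) : Prop :=
  ∃ φ : W → Set V,
    (∀ w : W, (G.induce (φ w)).Connected) ∧
    (Pairwise fun w w' => Disjoint (φ w) (φ w')) ∧
    (∀ a b : W, H.Adj a b → ∃ u ∈ φ a, ∃ v ∈ φ b, G.Adj u v)

/-- A bundled finite graph. -/
structure FGraph : Type 1 where
  V : Type
  [fintypeV : Fintype V]
  G : SimpleGraph V

attribute [instance] FGraph.fintypeV

/-- A class of graphs is nowhere dense if for every `r` there is `m` such that
`K_m` is not a depth-`r` minor of any member. -/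
def NowhereDense (C : Set FGraph) : Prop :=
  ∀ r : ℕ, ∃ m : ℕ, ∀ G ∈ C, ¬ IsDepthMinor r (⊤ : SimpleGraph (Fin m)) G.G

/-- A class of graphs has bounded expansion if for every `r` the edge density of
depth-`r` minors of members is bounded. -/
def BoundedExpansion (C : Set FGraph) : Prop :=
  ∀ r : ℕ, ∃ d : ℝ, ∀ G ∈ C, ∀ (n : ℕ) (H : SimpleGraph (Fin n)),
    IsDepthMinor r H G.G → (H.edgeSet.ncard : ℝ) / (n : ℝ) ≤ d

/-- `H` is (isomorphic to) a subgraph of `G`. -/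
def IsSubgraphOf (H G : FGraph) : Prop :=
  ∃ f : H.V → G.V, Function.Injective f ∧ ∀ a b : H.V, H.G.Adj a b → G.G.Adj (f a) (f b)

/-- `N_r^{G-S}(v)`, the ball of radius `r` around `v` in `G - S`, as a subset of `V`. -/
def ballAvoiding (G : SimpleGraph V) (S : Set V) (r : ℕ) (v : V) : Set V :=
  {u | ∃ p : G.Walk v u, p.length ≤ r ∧ ∀ x ∈ p.support, x ∉ S}

/-- `B` is distance-`r` independent in `G - S`: distinct vertices of `B` have
distance greater than `r` in `G - S`. -/
def DistIndepIn (G : SimpleGraph V) (S : Set V) (r : ℕ) (B : Set V) : Prop :=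
  ∀ u ∈ B, ∀ v ∈ B, u ≠ v →
    ∀ p : G.Walk u v, (∀ x ∈ p.support, x ∉ S) → r < p.length

/-- Uniform quasi-wideness. -/
def UniformlyQuasiWide (C : Set FGraph) : Prop :=
  ∀ r : ℕ, ∃ s : ℕ, ∀ m : ℕ, ∃ N : ℕ, ∀ G ∈ C, ∀ A : Set G.V,
    N ≤ A.ncard → ∃ S : Set G.V, S.ncard ≤ s ∧
      ∃ B ⊆ A \ S, m ≤ B.ncard ∧ DistIndepIn G.G S r B

/-- Splitter wins the simple `ℓ`-round radius-`r` splitter game on `G`. -/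
def SplitterWins (r : ℕ) : (ℓ : ℕ) → (V : Type) → SimpleGraph V → Prop
  | 0, V, _ => IsEmpty V
  | (ℓ + 1), _, G =>
      ∀ C : G.Subgraph, hasRadiusLE C.coe r →
        ∃ w ∈ C.verts, SplitterWins r ℓ _ ((C.deleteVerts {w}).coe)

/-- Splitter wins the `ℓ`-round treedepth game on `G`. -/
def TDSplitterWins : (ℓ : ℕ) → (V : Type) → SimpleGraph V → Prop
  | 0, V, _ => IsEmpty V
  | (ℓ + 1), _, G =>
      ∀ c : G.ConnectedComponent, ∃ w ∈ c.supp,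
        TDSplitterWins ℓ _ (G.induce (c.supp \ {w}))

/-- Splitter wins the variant of the `ℓ`-round radius-`r` splitter game in which
she may delete up to `m` vertices per round. -/
def SplitterWinsSets (r m : ℕ) : (ℓ : ℕ) → (V : Type) → SimpleGraph V → Prop
  | 0, V, _ => IsEmpty V
  | (ℓ + 1), _, G =>
      ∀ C : G.Subgraph, hasRadiusLE C.coe r →
        ∃ W ⊆ C.verts, W.ncard ≤ m ∧ SplitterWinsSets r m ℓ _ ((C.deleteVerts W).coe)

/-- `le` is the ancestor order of a rooted forest: a partial order in which the
set of ancestors of any element is a chain. -/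
def IsForestOrder (le : V → V → Prop) : Prop :=
  (∀ v, le v v) ∧ (∀ u v w, le u v → le v w → le u w) ∧
  (∀ u v, le u v → le v u → u = v) ∧
  (∀ v u w, le u v → le w v → le u w ∨ le w u)

/-- `G` has treedepth at most `ℓ`: there is a rooted forest of depth at most `ℓ`
on `V(G)` such that every edge joins an ancestor-descendant pair. -/
def TreedepthLE (G : SimpleGraph V) (ℓ : ℕ) : Prop :=
  ∃ le : V → V → Prop, IsForestOrder le ∧
    (∀ u v, G.Adj u v → le u v ∨ le v u) ∧
    ∀ v, ({u | le u v}).ncard ≤ ℓ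

/-- The treedepth of `G`. -/
noncomputable def treedepth (G : SimpleGraph V) : ℕ := sInf {ℓ | TreedepthLE G ℓ}

/-- `WReach G le r v`: the set of vertices weakly `r`-reachable from `v`
with respect to the linear order `le`. -/
def WReach (G : SimpleGraph V) (le : V → V → Prop) (r : ℕ) (v : V) : Set V :=
  {u | le u v ∧ ∃ p : G.Walk u v, p.IsPath ∧ p.length ≤ r ∧
    ∀ x ∈ p.support, x ≠ u → x ≠ v → le u x ∧ u ≠ x}

/-- `WReachInf G le v`: the set of vertices weakly reachable from `v`
with respect to the linear order `le` (no bound on path length). -/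
def WReachInf (G : SimpleGraph V) (le : V → V → Prop) (v : V) : Set V :=
  {u | le u v ∧ ∃ p : G.Walk u v, p.IsPath ∧
    ∀ x ∈ p.support, x ≠ u → x ≠ v → le u x ∧ u ≠ x}

/-- The weak `r`-coloring number of `G`. -/
noncomputable def wcol (G : SimpleGraph V) (r : ℕ) : ℕ :=
  sInf {k | ∃ le : V → V → Prop, IsLinearOrder V le ∧ ∀ v, (WReach G le r v).ncard ≤ k}

/-- The coloring number of `G`: the least `k` such that some linear order has
every vertex with at most `k - 1` smaller neighbors. -/
noncomputable def coloringNumber (G : SimpleGraph V) : ℕ :=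
  sInf {k | ∃ le : V → V → Prop, IsLinearOrder V le ∧
    ∀ v, ({u | G.Adj u v ∧ le u v ∧ u ≠ v}).ncard + 1 ≤ k}

/-- `X` is an `r`-neighborhood cover of `G` with clusters of radius at most `ρ`:
each cluster induces a connected subgraph of radius at most `ρ`, and every
`r`-ball is contained in some cluster. -/
def IsNbhdCover (G : SimpleGraph V) (r ρ : ℕ) (X : Set (Set V)) : Prop :=
  (∀ C ∈ X, hasRadiusLE (G.induce C) ρ) ∧ ∀ v : V, ∃ C ∈ X, ball G r v ⊆ C

/-- The cluster `X_r[G,π,u] = {w : u ∈ WReach_r[G,π,w]}`. -/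
def XCluster (G : SimpleGraph V) (le : V → V → Prop) (r : ℕ) (u : V) : Set V :=
  {w | u ∈ WReach G le r w}

/-- The smaller endpoint of an edge. -/
def sym2Min {n : ℕ} (e : Sym2 (Fin n)) : Fin n :=
  Sym2.lift ⟨fun a b => min a b, fun _ _ => min_comm _ _⟩ e

/-- The larger endpoint of an edge. -/
def sym2Max {n : ℕ} (e : Sym2 (Fin n)) : Fin n :=
  Sym2.lift ⟨fun a b => max a b, fun _ _ => max_comm _ _⟩ e

/-- The relation generating the `r`-subdivision of `G`. -/
def SubdivRel {n : ℕ} (r : ℕ) (G : SimpleGraph (Fin n)) :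
    (Fin n ⊕ (G.edgeSet × Fin r)) → (Fin n ⊕ (G.edgeSet × Fin r)) → Prop
  | Sum.inl a, Sum.inl b => r = 0 ∧ G.Adj a b
  | Sum.inl a, Sum.inr ei => ((ei.2 : ℕ) = 0 ∧ a = sym2Min ei.1.1) ∨
      ((ei.2 : ℕ) = r - 1 ∧ a = sym2Max ei.1.1)
  | Sum.inr ei, Sum.inr ej => ei.1 = ej.1 ∧ (ei.2 : ℕ) + 1 = (ej.2 : ℕ)
  | Sum.inr _, Sum.inl _ => False

/-- The `r`-subdivision of `G`: every edge is replaced by a path with `r`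
internal vertices. -/
def Subdivision {n : ℕ} (r : ℕ) (G : SimpleGraph (Fin n)) :
    SimpleGraph ((Fin n) ⊕ (G.edgeSet × Fin r)) :=
  SimpleGraph.fromRel (SubdivRel r G)

namespace SimpleGraph

section Walks

variable {U : Type} {G : SimpleGraph U}

theorem Walk.length_induce {s : Set U} {u v : U} (p : G.Walk u v) (hp : ∀ x ∈ p.support, x ∈ s) :
    (p.induce s hp).length = p.length := by
  induction p with
  | nil => rfl
  | cons h p ih => simp [ih]

theorem hasRadiusLE_induce {s : Set U} {r : ℕ} {c : U} (hc : c ∈ s)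
    (h : ∀ x ∈ s, ∃ p : G.Walk c x, p.length ≤ r ∧ ∀ y ∈ p.support, y ∈ s) :
    hasRadiusLE (G.induce s) r := by
  refine ⟨⟨c, hc⟩, fun ⟨x, hx⟩ ↦ ?_⟩
  obtain ⟨p, hp, hs⟩ := h x hx
  exact ⟨p.induce s hs, (p.length_induce hs).trans_le hp⟩

/-- A walk entering a set has an initial segment that avoids the set and ends next to it. -/
theorem Walk.exists_first_hit {A : Set U} {u t : U} (p : G.Walk u t) (hu : u ∉ A) (ht : t ∈ A) :
    ∃ y w, ∃ q : G.Walk u y, G.Adj y w ∧ w ∈ A ∧ w ∈ p.support ∧ q.support ⊆ p.support ∧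
      (∀ x ∈ q.support, x ∉ A) ∧ q.length < p.length := by
  induction p with
  | nil => exact absurd ht hu
  | @cons u u' t h p ih =>
    by_cases hu' : u' ∈ A
    · exact ⟨u, u', nil, h, hu', by simp, by simp, by simpa using hu, by simp⟩
    · obtain ⟨y, w, q, hyw, hw, hwp, hqp, hqA, hlen⟩ := ih hu' ht
      refine ⟨y, w, cons h q, hyw, hw, by simp [hwp], ?_, ?_, by simpa using hlen⟩
      · exact List.cons_subset_cons _ hqp
      · simpa using ⟨hu, hqA⟩

end Walks

/-- If few ordered pairs of `E` are present relative to the size of `S`, then `S` contains a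
large set independent with respect to `E`. -/
theorem exists_large_independent {U : Type} [Fintype U] (S : Finset U) (E : Finset (U × U)) (c : ℕ)
    (hE : E.card ≤ c * S.card) :
    ∃ I ⊆ S, (∀ a ∈ I, ∀ b ∈ I, a ≠ b → (a, b) ∉ E) ∧ S.card ≤ 2 * (1 + 4 * c) * I.card := by
  classical
  let nb : U → Finset U := fun v ↦
    (E.filter (·.1 = v)).image Prod.snd ∪ (E.filter (·.2 = v)).image Prod.fst
  have mem_nb : ∀ a b, (a, b) ∈ E → b ∈ nb a ∧ a ∈ nb b := by
    intro a b h
    simp [nb, h]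
  have hsum : ∑ v ∈ S, (nb v).card ≤ 2 * E.card := by
    have h1 := Finset.card_eq_sum_card_fiberwise (f := Prod.fst) (s := E) (t := Finset.univ)
      (by simp)
    have h2 := Finset.card_eq_sum_card_fiberwise (f := Prod.snd) (s := E) (t := Finset.univ)
      (by simp)
    calc ∑ v ∈ S, (nb v).card ≤ ∑ v, (nb v).card :=
          Finset.sum_le_sum_of_subset (Finset.subset_univ _)
      _ ≤ ∑ v, ((E.filter (·.1 = v)).card + (E.filter (·.2 = v)).card) :=
          Finset.sum_le_sum fun v _ ↦ (Finset.card_union_le _ _).trans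
            (add_le_add Finset.card_image_le Finset.card_image_le)
      _ = 2 * E.card := by rw [Finset.sum_add_distrib, ← h1, ← h2, two_mul]
  set S' := S.filter (fun v ↦ (nb v).card ≤ 4 * c) with hS'
  have hhalf : S.card ≤ 2 * S'.card := by
    have h1 : (S.filter (fun v ↦ ¬ (nb v).card ≤ 4 * c)).card * (4 * c + 1) ≤ 2 * E.card := by
      rw [← smul_eq_mul]
      refine (Finset.card_nsmul_le_sum _ (fun v ↦ (nb v).card) _ ?_).trans
        ((Finset.sum_le_sum_of_subset (Finset.filter_subset _ _)).trans hsum)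
      intro v hv
      simp at hv
      omega
    have h2 := Finset.card_filter_add_card_filter_not (s := S) (fun v ↦ (nb v).card ≤ 4 * c)
    rw [← hS'] at h2
    by_contra hlt
    nlinarith
  obtain ⟨I, hI⟩ := Finset.exists_maximal
    (s := S'.powerset.filter fun I ↦ ∀ a ∈ I, ∀ b ∈ I, a ≠ b → (a, b) ∉ E) ⟨∅, by simp⟩
  have hIm := hI.prop
  simp only [Finset.mem_filter, Finset.mem_powerset] at hIm
  refine ⟨I, hIm.1.trans (Finset.filter_subset _ _), hIm.2, ?_⟩
  have hcov : S' ⊆ I.biUnion fun v ↦ insert v (nb v) := by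
    intro x hx
    simp only [Finset.mem_biUnion, Finset.mem_insert]
    by_contra! hno
    have hxI : x ∉ I := fun h ↦ (hno x h).1 rfl
    have hins : insert x I ∈
        S'.powerset.filter fun I ↦ ∀ a ∈ I, ∀ b ∈ I, a ≠ b → (a, b) ∉ E := by
      simp only [Finset.mem_filter, Finset.mem_powerset]
      refine ⟨Finset.insert_subset hx hIm.1, ?_⟩
      intro a ha b hb hab h
      rcases Finset.mem_insert.1 ha with rfl | haI <;>
        rcases Finset.mem_insert.1 hb with rfl | hbI
      · exact hab rfl
      · exact (hno b hbI).2 (mem_nb _ _ h).2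
      · exact (hno a haI).2 (mem_nb _ _ h).1
      · exact hIm.2 a haI b hbI hab h
    exact hxI (hI.le_of_ge hins (Finset.subset_insert _ _) (Finset.mem_insert_self _ _))
  have hcard : S'.card ≤ I.card * (1 + 4 * c) := by
    refine (Finset.card_le_card hcov).trans (Finset.card_biUnion_le_card_mul _ _ _ ?_)
    intro v hv
    have := (Finset.mem_filter.1 (hIm.1 hv)).2
    have := Finset.card_insert_le v (nb v)
    omega
  nlinarith

section Density

variable {U : Type} {G : SimpleGraph U}

/-- Counting ordered pairs of adjacent branch sets in a graph whose shallow minors are sparse. -/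
theorem card_pairs_le_of_branchSets {R D : ℕ}
    (hD : ∀ (n : ℕ) (H : SimpleGraph (Fin n)), IsDepthMinor R H G → H.edgeSet.ncard ≤ D * n)
    (N : Finset U) (B : U → Set U) (hB : ∀ a ∈ N, hasRadiusLE (G.induce (B a)) R)
    (hdisj : ∀ a ∈ N, ∀ b ∈ N, a ≠ b → Disjoint (B a) (B b)) (F : Finset (U × U))
    (hF : ∀ e ∈ F, e.1 ∈ N ∧ e.2 ∈ N ∧ e.1 ≠ e.2 ∧ ∃ u ∈ B e.1, ∃ v ∈ B e.2, G.Adj u v) :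
    F.card ≤ 2 * D * N.card := by
  classical
  let f := N.equivFin
  let H : SimpleGraph (Fin N.card) :=
    SimpleGraph.fromRel fun a b ↦ ((f.symm a : U), (f.symm b : U)) ∈ F
  have hH : IsDepthMinor R H G := by
    refine ⟨fun i ↦ B (f.symm i), fun i ↦ hB _ (f.symm i).2, fun i j hij ↦ ?_, fun i j hij ↦ ?_⟩
    · exact hdisj _ (f.symm i).2 _ (f.symm j).2
        fun h ↦ hij (f.symm.injective (Subtype.ext h))
    · rcases (SimpleGraph.fromRel_adj _ _ _).1 hij with ⟨-, h | h⟩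
      · exact (hF _ h).2.2.2
      · obtain ⟨u, hu, v, hv, huv⟩ := (hF _ h).2.2.2
        exact ⟨v, hv, u, hu, huv.symm⟩
  have hcard := hD _ H hH
  rw [Set.ncard_eq_toFinset_card'] at hcard
  have hle : F.card ≤ 2 * (H.edgeSet.toFinset.image (Sym2.map fun i ↦ (f.symm i : U))).card := by
    refine Finset.card_le_mul_card_image_of_maps_to (f := fun e ↦ s(e.1, e.2)) ?_ 2 ?_
    · rintro ⟨a, b⟩ he
      obtain ⟨ha, hb, hab, -⟩ := hF _ he
      refine Finset.mem_image.2 ⟨s(f ⟨a, ha⟩, f ⟨b, hb⟩), ?_, by simp⟩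
      simp only [Set.mem_toFinset, mem_edgeSet]
      refine (SimpleGraph.fromRel_adj _ _ _).2 ⟨?_, Or.inl (by simpa using he)⟩
      simpa using hab
    · intro e _
      induction e using Sym2.ind with
      | _ x y =>
        refine (Finset.card_le_card (t := {(x, y), (y, x)}) ?_).trans Finset.card_le_two
        rintro ⟨a, b⟩ he
        have := (Finset.mem_filter.1 he).2
        simp only [Sym2.eq_iff] at this
        simp only [Finset.mem_insert, Finset.mem_singleton, Prod.mk.injEq]
        exact this
  calc F.card ≤ 2 * H.edgeSet.toFinset.card :=
        hle.trans (Nat.mul_le_mul_left _ Finset.card_image_le)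
    _ ≤ 2 * (D * N.card) := Nat.mul_le_mul_left _ hcard
    _ = 2 * D * N.card := by ring

/-- `Q` is the interior of a connection of size at most `k` from `a` to `b`: it is attached to `a`,
and some vertex of `Q ∪ {a}` is adjacent to `b`. -/
def IsLink (G : SimpleGraph U) (k : ℕ) (a b : U) (Q : Finset U) : Prop :=
  Q.card ≤ k ∧
    (∀ x ∈ Q, ∃ p : G.Walk a x, p.length ≤ k ∧ ∀ y ∈ p.support, y = a ∨ y ∈ Q) ∧
    ∃ y, (y = a ∨ y ∈ Q) ∧ G.Adj y b

/-- `Q` provides links outside `S`, pairwise disjoint, for the pairs `E` of vertices of `S`. -/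
structure IsLinkSystem (G : SimpleGraph U) (k : ℕ) (S : Finset U) (E : Finset (U × U))
    (Q : U × U → Finset U) : Prop where
  left_mem : ∀ e ∈ E, e.1 ∈ S
  right_mem : ∀ e ∈ E, e.2 ∈ S
  ne : ∀ e ∈ E, e.1 ≠ e.2
  isLink : ∀ e ∈ E, IsLink G k e.1 e.2 (Q e)
  disjoint_base : ∀ e ∈ E, Disjoint (Q e) S
  disjoint : ∀ e ∈ E, ∀ e' ∈ E, e ≠ e' → Disjoint (Q e) (Q e')

theorem Walk.exists_isLink {M : Set U} {k : ℕ} {a b : U} (p : G.Walk a b) (hp : p.length ≤ k)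
    (hab : a ≠ b) (hb : b ∈ M) (hM : ∀ x ∈ p.support, x ∈ M → x = a ∨ x = b) :
    ∃ Q, IsLink G k a b Q ∧ ∀ x ∈ Q, x ∉ M := by
  classical
  obtain ⟨y, w, q, hyw, hwA, hwp, hqp, hqA, hlen⟩ :=
    p.exists_first_hit (A := M \ {a}) (by simp) ⟨hb, hab.symm⟩
  obtain rfl : w = b := (hM w hwp hwA.1).resolve_left hwA.2
  have mem : ∀ z ∈ q.support, z = a ∨ z ∈ q.support.toFinset.erase a := by
    intro z hz
    simpa [hz] using em (z = a)
  refine ⟨q.support.toFinset.erase a, ⟨?_, fun x hx ↦ ?_, y, mem y q.end_mem_support, hyw⟩, ?_⟩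
  · have h1 := q.support.toFinset_card_le
    rw [q.length_support] at h1
    have := Finset.card_erase_le (s := q.support.toFinset) (a := a)
    omega
  · have hx' : x ∈ q.support := by simpa using Finset.mem_of_mem_erase hx
    refine ⟨q.takeUntil x hx', ?_, fun z hz ↦ mem z (q.support_takeUntil_subset_support hx' hz)⟩
    have := q.length_takeUntil_le_length hx'
    omega
  · intro x hx hxM
    obtain ⟨hxa, hx'⟩ := Finset.mem_erase.1 hx
    exact hqA x (by simpa using hx') ⟨hxM, hxa⟩

theorem IsLinkSystem.card_le {k D : ℕ} {S : Finset U} {E : Finset (U × U)} {Q : U × U → Finset U}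
    (hD : ∀ (n : ℕ) (H : SimpleGraph (Fin n)), IsDepthMinor k H G → H.edgeSet.ncard ≤ D * n)
    (h : IsLinkSystem G k S E Q) : E.card ≤ 2 * D * S.card := by
  have notMem_base : ∀ e ∈ E, ∀ x ∈ Q e, x ∉ S := fun e he x hx hxS ↦
    Finset.disjoint_left.1 (h.disjoint_base e he) hx hxS
  refine card_pairs_le_of_branchSets hD S
    (fun a ↦ {x | x = a ∨ ∃ b, (a, b) ∈ E ∧ x ∈ Q (a, b)}) ?_ ?_ E ?_
  · intro a _
    refine hasRadiusLE_induce (c := a) (Or.inl rfl) ?_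
    rintro x (rfl | ⟨b, hb, hx⟩)
    · exact ⟨Walk.nil, by simp, by simp⟩
    · obtain ⟨p, hp, hs⟩ := (h.isLink _ hb).2.1 x hx
      exact ⟨p, hp, fun y hy ↦ (hs y hy).imp id fun hy ↦ ⟨b, hb, hy⟩⟩
  · intro a ha b hb hab
    refine Set.disjoint_left.2 ?_
    rintro x (rfl | ⟨c, hc, hx⟩) (rfl | ⟨d, hd, hx'⟩)
    · exact hab rfl
    · exact notMem_base _ hd _ hx' ha
    · exact notMem_base _ hc _ hx hb
    · exact Finset.disjoint_left.1 (h.disjoint _ hc _ hd fun h ↦ hab (congrArg Prod.fst h)) hx hx'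
  · rintro ⟨a, b⟩ he
    obtain ⟨y, hy, hyb⟩ := (h.isLink _ he).2.2
    exact ⟨h.left_mem _ he, h.right_mem _ he, h.ne _ he, y,
      hy.imp id fun hy ↦ ⟨b, he, hy⟩, b, Or.inl rfl, hyb⟩

/-- There is a link system which cannot be extended by a further link. -/
theorem exists_maximal_linkSystem [Fintype U] [DecidableEq U] (G : SimpleGraph U) (k : ℕ)
    (S : Finset U) :
    ∃ E Q, IsLinkSystem G k S E Q ∧ ∀ a ∈ S, ∀ b ∈ S, a ≠ b → (a, b) ∉ E →
      ∀ P, IsLink G k a b P → ¬ ∀ x ∈ P, x ∉ S ∪ E.biUnion Q := by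
  classical
  obtain ⟨E, hE⟩ := Finset.exists_maximal
    (s := Finset.univ.filter fun E : Finset (U × U) ↦ ∃ Q, IsLinkSystem G k S E Q)
    ⟨∅, by simpa using ⟨fun _ ↦ ∅, by constructor <;> simp⟩⟩
  obtain ⟨Q, hQ⟩ := (Finset.mem_filter.1 hE.prop).2
  refine ⟨E, Q, hQ, fun a ha b hb hab habE P hP hPM ↦ habE ?_⟩
  have hPS : Disjoint P S := Finset.disjoint_left.2 fun x hx hxS ↦ hPM x hx (by simp [hxS])
  have hPQ : ∀ e ∈ E, Disjoint P (Q e) := fun e he ↦ Finset.disjoint_left.2 fun x hx hxQ ↦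
    hPM x hx (Finset.mem_union_right _ (Finset.mem_biUnion.2 ⟨e, he, hxQ⟩))
  have hself : Function.update Q (a, b) P (a, b) = P := Function.update_self ..
  have hother : ∀ e ∈ E, Function.update Q (a, b) P e = Q e := fun e he ↦
    Function.update_of_ne (fun h : e = (a, b) ↦ habE (h ▸ he)) ..
  have hsys : IsLinkSystem G k S (insert (a, b) E) (Function.update Q (a, b) P) := by
    constructor
    · exact Finset.forall_mem_insert _ _ _ |>.2 ⟨ha, hQ.left_mem⟩
    · exact Finset.forall_mem_insert _ _ _ |>.2 ⟨hb, hQ.right_mem⟩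
    · exact Finset.forall_mem_insert _ _ _ |>.2 ⟨hab, hQ.ne⟩
    · refine Finset.forall_mem_insert _ _ _ |>.2 ⟨by rwa [hself], fun e he ↦ ?_⟩
      rw [hother e he]
      exact hQ.isLink e he
    · refine Finset.forall_mem_insert _ _ _ |>.2 ⟨by rwa [hself], fun e he ↦ ?_⟩
      rw [hother e he]
      exact hQ.disjoint_base e he
    · intro e he e' he' hne
      rcases Finset.mem_insert.1 he with rfl | heE <;>
        rcases Finset.mem_insert.1 he' with rfl | heE'
      · exact absurd rfl hne
      · rw [hself, hother _ heE']
        exact hPQ _ heE'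
      · rw [hself, hother _ heE]
        exact (hPQ _ heE).symm
      · rw [hother _ heE, hother _ heE']
        exact hQ.disjoint _ heE _ heE' hne
  exact hE.le_of_ge (Finset.mem_filter.2 ⟨Finset.mem_univ _, _, hsys⟩)
    (Finset.subset_insert _ _) (Finset.mem_insert_self _ _)

/-- If shallow minors are sparse, every nonempty vertex set contains a vertex whose short walks to
the rest of the set can be hit by few vertices. -/
theorem exists_small_hittingSet [Fintype U] {r D : ℕ}
    (hD : ∀ (n : ℕ) (H : SimpleGraph (Fin n)), IsDepthMinor (2 * r) H G → H.edgeSet.ncard ≤ D * n)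
    (S : Finset U) (hS : S.Nonempty) :
    ∃ v ∈ S, ∃ X : Finset U, X.card ≤ 4 * D * (1 + 4 * D * r) * (1 + 8 * D) ∧ v ∉ X ∧
      ∀ u ∈ S, u ≠ v → ∀ p : G.Walk v u, p.length ≤ r → ∃ x ∈ X, x ∈ p.support := by
  classical
  obtain ⟨E, Q, hQ, hmax⟩ := exists_maximal_linkSystem G (2 * r) S
  have hEcard := hQ.card_le hD
  obtain ⟨I, hIS, hI, hIcard⟩ := exists_large_independent S E (2 * D) hEcard
  set M := S ∪ E.biUnion Q with hM
  have hSM : S ⊆ M := Finset.subset_union_left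
  have hMcard : M.card ≤ (1 + 4 * D * r) * S.card := by
    have h1 : (E.biUnion Q).card ≤ E.card * (2 * r) :=
      Finset.card_biUnion_le_card_mul _ _ _ fun e he ↦ (hQ.isLink e he).1
    have h2 := Finset.card_union_le S (E.biUnion Q)
    have h3 : E.card * (2 * r) ≤ 2 * D * S.card * (2 * r) := Nat.mul_le_mul_right _ hEcard
    rw [← hM] at h2
    linarith
  let Y : U → Set U := fun v ↦
    {x | ∃ q : G.Walk v x, q.length ≤ r ∧ ∀ y ∈ q.support, y ∈ M → y = v}
  let W : U → Finset U := fun v ↦ M.filter fun w ↦ w ≠ v ∧ ∃ y ∈ Y v, G.Adj y w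
  have self_mem : ∀ v, v ∈ Y v := fun v ↦ ⟨Walk.nil, by simp, by simp⟩
  have hYM : ∀ v, ∀ x ∈ Y v, x ∈ M → x = v := fun v x ⟨q, _, hq⟩ hx ↦ hq x q.end_mem_support hx
  have hYdisj : ∀ v ∈ I, ∀ v' ∈ I, v ≠ v' → Disjoint (Y v) (Y v') := by
    intro v hv v' hv' hne
    refine Set.disjoint_left.2 ?_
    rintro x ⟨q, hq, hqM⟩ ⟨q', hq', hqM'⟩
    obtain ⟨P, hP, hPM⟩ := (q.append q'.reverse).exists_isLink (M := (M : Set U)) (k := 2 * r)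
      (by simp; omega) hne (hSM (hIS hv')) (by
        intro y hy hyM
        rcases (Walk.mem_support_append_iff ..).1 hy with hy | hy
        · exact Or.inl (hqM y hy hyM)
        · exact Or.inr (hqM' y (by simpa using hy) hyM))
    exact hmax v (hIS hv) v' (hIS hv') hne (hI v hv v' hv' hne) P hP hPM
  have hpairs : (I.sigma W).card ≤ 2 * D * M.card := by
    rw [← Finset.card_map (Equiv.sigmaEquivProd U U).toEmbedding]
    refine card_pairs_le_of_branchSets hD M (fun a ↦ if a ∈ I then Y a else {a}) ?_ ?_ _ ?_
    · intro a _
      refine hasRadiusLE_induce (c := a) (by split_ifs <;> simp [self_mem]) ?_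
      split_ifs
      · rintro x ⟨q, hq, hqM⟩
        refine ⟨q, by omega, fun y hy ↦ ⟨q.takeUntil y hy, ?_, fun z hz ↦ hqM z ?_⟩⟩
        · exact (q.length_takeUntil_le_length hy).trans hq
        · exact q.support_takeUntil_subset_support hy hz
      · rintro x rfl
        exact ⟨Walk.nil, by simp, by simp⟩
    · intro a ha b hb hab
      split_ifs with haI hbI hbI
      · exact hYdisj a haI b hbI hab
      · exact Set.disjoint_singleton_right.2 fun h ↦ hab (hYM a b h hb).symm
      · exact Set.disjoint_singleton_left.2 fun h ↦ hab (hYM b a h ha)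
      · exact Set.disjoint_singleton.2 hab
    · rintro ⟨v, w⟩ he
      obtain ⟨hv, hw⟩ : v ∈ I ∧ w ∈ W v := by simpa using he
      obtain ⟨hwM, hwv, y, hy, hyw⟩ := Finset.mem_filter.1 hw
      refine ⟨hSM (hIS hv), hwM, hwv.symm, y, by simpa [hv] using hy, w, ?_, hyw⟩
      split_ifs <;> simp [self_mem]
  have hIpos : 0 < I.card := by
    have := hS.card_pos
    by_contra h
    have h0 : I.card = 0 := by omega
    rw [h0] at hIcard
    omega
  obtain ⟨v, hv, hvW⟩ : ∃ v ∈ I, (W v).card ≤ 4 * D * (1 + 4 * D * r) * (1 + 8 * D) := by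
    refine Finset.exists_le_of_sum_le (Finset.card_pos.1 hIpos) ?_
    rw [← Finset.card_sigma, Finset.sum_const, smul_eq_mul]
    calc (I.sigma W).card ≤ 2 * D * M.card := hpairs
      _ ≤ 2 * D * ((1 + 4 * D * r) * (2 * (1 + 4 * (2 * D)) * I.card)) :=
          Nat.mul_le_mul_left _ (hMcard.trans (Nat.mul_le_mul_left _ hIcard))
      _ = I.card * (4 * D * (1 + 4 * D * r) * (1 + 8 * D)) := by ring
  refine ⟨v, hIS hv, W v, hvW, by simp [W], fun u hu huv p hp ↦ ?_⟩
  obtain ⟨y, w, q, hyw, hw, hwp, -, hq, hlen⟩ :=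
    p.exists_first_hit (A := (M : Set U) \ {v}) (by simp) ⟨hSM hu, huv⟩
  refine ⟨w, Finset.mem_filter.2 ⟨hw.1, hw.2, y, ⟨q, by omega, fun z hz hzM ↦ ?_⟩, hyw⟩, hwp⟩
  by_contra hzv
  exact hq z hz ⟨hzM, hzv⟩

end Density

section Orders

variable {U : Type} {G : SimpleGraph U}

/-- Greedy elimination: a property that holds for some vertex of every nonempty set can be made to
hold along an enumeration, for each vertex relative to the set of vertices not after it. -/
theorem exists_elimination_order (P : Finset U → U → Prop)
    (hP : ∀ S : Finset U, S.Nonempty → ∃ v ∈ S, P S v) (S : Finset U) :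
    ∃ f : U → ℕ, Set.InjOn f S ∧ (∀ v ∈ S, f v < S.card) ∧
      ∀ v ∈ S, P (S.filter fun u ↦ f u ≤ f v) v := by
  classical
  induction S using Finset.strongInduction with
  | H S ih =>
    rcases S.eq_empty_or_nonempty with rfl | hS
    · exact ⟨fun _ ↦ 0, by simp, by simp, by simp⟩
    obtain ⟨v, hv, hPv⟩ := hP S hS
    obtain ⟨f, hinj, hlt, hf⟩ := ih _ (Finset.erase_ssubset hv)
    have hcard := Finset.card_erase_add_one hv
    let g := Function.update f v (S.erase v).card
    have hgv : g v = (S.erase v).card := Function.update_self ..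
    have hg : ∀ u, u ≠ v → g u = f u := fun u hu ↦ Function.update_of_ne hu ..
    have hgu : ∀ u ∈ S, u ≠ v → g u < g v := fun u hu huv ↦ by
      rw [hg u huv, hgv]
      exact hlt u (Finset.mem_erase.2 ⟨huv, hu⟩)
    refine ⟨g, fun a ha b hb hab ↦ ?_, fun u hu ↦ ?_, fun u hu ↦ ?_⟩
    · by_cases hav : a = v <;> by_cases hbv : b = v
      · rw [hav, hbv]
      · subst hav
        exact absurd hab (hgu b hb hbv).ne'
      · subst hbv
        exact absurd hab (hgu a ha hav).ne
      · rw [hg a hav, hg b hbv] at hab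
        exact hinj (Finset.mem_erase.2 ⟨hav, ha⟩) (Finset.mem_erase.2 ⟨hbv, hb⟩) hab
    · by_cases huv : u = v
      · rw [huv, hgv]
        omega
      · have := hgu u hu huv
        omega
    · by_cases huv : u = v
      · subst huv
        rwa [Finset.filter_true_of_mem]
        intro w hw
        by_cases hwu : w = u
        · rw [hwu]
        · exact (hgu w hw hwu).le
      · have := hf u (Finset.mem_erase.2 ⟨huv, hu⟩)
        convert this using 1
        ext w
        simp only [Finset.mem_filter, Finset.mem_erase]
        constructor
        · rintro ⟨hw, hle⟩
          have hwv : w ≠ v := by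
            rintro rfl
            exact absurd hle (hgu u hu huv).not_ge
          rw [hg w hwv, hg u huv] at hle
          exact ⟨⟨hwv, hw⟩, hle⟩
        · rintro ⟨⟨hwv, hw⟩, hle⟩
          rw [hg w hwv, hg u huv]
          exact ⟨hw, hle⟩

theorem isLinearOrder_of_injective {f : U → ℕ} (hf : Function.Injective f) :
    IsLinearOrder U fun a b ↦ f a ≤ f b where
  refl _ := le_rfl
  trans _ _ _ := le_trans
  antisymm _ _ h h' := hf (le_antisymm h h')
  total a b := le_total (f a) (f b)

/-- If short walks to smaller vertices can be hit by few vertices, then few vertices are weakly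
reachable. -/
theorem ncard_WReach_le [Fintype U] {f : U → ℕ} {r K : ℕ}
    (X : U → Finset U) (hX : ∀ v, (X v).card ≤ K) (hvX : ∀ v, v ∉ X v)
    (hhit : ∀ v u, f u ≤ f v → u ≠ v → ∀ p : G.Walk v u, p.length ≤ r → ∃ x ∈ X v, x ∈ p.support)
    (j : ℕ) (hj : j ≤ r) (v : U) :
    {u | f u ≤ f v ∧ ∃ p : G.Walk v u, p.length ≤ j ∧ ∀ x ∈ p.support, f u ≤ f x}.ncard
      ≤ ∑ i ∈ Finset.range (j + 1), K ^ i := by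
  classical
  induction j generalizing v with
  | zero =>
    simp only [zero_add, Finset.range_one, Finset.sum_singleton, pow_zero]
    refine (Set.ncard_le_ncard (t := {v}) ?_).trans (Set.ncard_singleton v).le
    rintro u ⟨-, p, hp, -⟩
    exact (p.eq_of_length_eq_zero (by omega)).symm
  | succ j ih =>
    let R : U → Set U := fun v ↦
      {u | f u ≤ f v ∧ ∃ p : G.Walk v u, p.length ≤ j ∧ ∀ x ∈ p.support, f u ≤ f x}
    have hsub : {u | f u ≤ f v ∧ ∃ p : G.Walk v u, p.length ≤ j + 1 ∧
        ∀ x ∈ p.support, f u ≤ f x} ⊆ ↑(insert v ((X v).biUnion fun x ↦ (R x).toFinset)) := by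
      rintro u ⟨huv, p, hp, hmin⟩
      simp only [Finset.coe_insert, Finset.coe_biUnion, Set.mem_insert_iff, Set.mem_iUnion,
        Set.coe_toFinset, Finset.mem_coe]
      refine or_iff_not_imp_left.2 fun hne ↦ ?_
      obtain ⟨x, hx, hxp⟩ := hhit v u huv hne p (hp.trans hj)
      have hxv : x ≠ v := fun h ↦ hvX v (h ▸ hx)
      refine ⟨x, hx, hmin x hxp, p.dropUntil x hxp, ?_,
        fun y hy ↦ hmin y (p.support_dropUntil_subset_support hxp hy)⟩
      have := p.length_dropUntil_lt_length hxp hxv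
      omega
    refine (Set.ncard_le_ncard hsub).trans ?_
    rw [Set.ncard_coe_finset, Finset.sum_range_succ']
    refine (Finset.card_insert_le _ _).trans (Nat.add_le_add ?_ (by simp))
    simp_rw [pow_succ]
    rw [← Finset.sum_mul, mul_comm]
    refine (Finset.card_biUnion_le_card_mul _ _ _ fun x _ ↦ ?_).trans
      (Nat.mul_le_mul_right _ (hX v))
    rw [← Set.ncard_eq_toFinset_card']
    exact ih (by omega) x

theorem wcol_le_of_sparse_minors [Fintype U] {r D : ℕ}
    (hD : ∀ (n : ℕ) (H : SimpleGraph (Fin n)), IsDepthMinor (2 * r) H G →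
      H.edgeSet.ncard ≤ D * n) :
    wcol G r ≤ ∑ i ∈ Finset.range (r + 1), (4 * D * (1 + 4 * D * r) * (1 + 8 * D)) ^ i := by
  classical
  obtain ⟨f, hinj, -, hf⟩ := exists_elimination_order _ (exists_small_hittingSet hD) Finset.univ
  have hinj : Function.Injective f := by simpa [Set.injOn_univ] using hinj
  choose X hX hvX hhit using fun v ↦ hf v (Finset.mem_univ v)
  refine Nat.sInf_le ⟨fun a b ↦ f a ≤ f b, isLinearOrder_of_injective hinj, fun v ↦ ?_⟩
  refine (Set.ncard_le_ncard ?_).trans (ncard_WReach_le (f := f) X hX hvX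
    (fun v u huv ↦ hhit v u (by simpa using huv)) r le_rfl v)
  rintro u ⟨huv, p, -, hp, hmin⟩
  refine ⟨huv, p.reverse, by simpa using hp, fun x hx ↦ ?_⟩
  by_cases hxu : x = u
  · rw [hxu]
  by_cases hxv : x = v
  · rwa [hxv]
  exact (hmin x (by simpa using hx) hxu hxv).1

/-- The optimum in the definition of `wcol` is attained. -/
theorem exists_order_of_wcol [Fintype U] (G : SimpleGraph U) (r : ℕ) :
    ∃ le : U → U → Prop, IsLinearOrder U le ∧ ∀ v, (WReach G le r v).ncard ≤ wcol G r := by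
  refine Nat.sInf_mem (s := {k | ∃ le : U → U → Prop, IsLinearOrder U le ∧
    ∀ v, (WReach G le r v).ncard ≤ k}) ⟨Nat.card U, _, isLinearOrder_of_injective
      (f := fun v ↦ (Fintype.equivFin U v : ℕ)) (fun a b h ↦ ?_), fun v ↦ Set.ncard_le_card _⟩
  simpa [Fin.val_inj] using h

theorem hasRadiusLE.exists_walk {s : Set U} {r : ℕ} (h : hasRadiusLE (G.induce s) r) {x y : U}
    (hx : x ∈ s) (hy : y ∈ s) : ∃ p : G.Walk x y, p.length ≤ 2 * r ∧ ∀ z ∈ p.support, z ∈ s := by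
  obtain ⟨c, hc⟩ := h
  obtain ⟨p, hp⟩ := hc ⟨x, hx⟩
  obtain ⟨q, hq⟩ := hc ⟨y, hy⟩
  let e := (Embedding.induce (G := G) s).toHom
  refine ⟨(p.reverse.append q).map e, ?_, ?_⟩
  · refine (Walk.length_map e (p.reverse.append q)).trans_le ?_
    rw [Walk.length_append, Walk.length_reverse]
    omega
  · intro z hz
    obtain ⟨w, -, rfl⟩ := List.mem_map.1
      ((congrArg (z ∈ ·) (Walk.support_map e (p.reverse.append q))).mp hz)
    exact w.2

theorem IsDepthMinor.card_edgeSet_le [Fintype U] {r n : ℕ} {H : SimpleGraph (Fin n)}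
    (h : IsDepthMinor r H G) : H.edgeSet.ncard ≤ wcol G (4 * r + 1) * n := by
  classical
  obtain ⟨φ, hrad, hdisj, hadj⟩ := h
  obtain ⟨le, hle, hw⟩ := exists_order_of_wcol G (4 * r + 1)
  have hmin : ∀ a, ∃ m ∈ φ a, ∀ x ∈ φ a, le m x := by
    intro a
    obtain ⟨⟨c, hc⟩, -⟩ := hrad a
    let : LinearOrder U :=
      { le := le
        le_refl := hle.refl
        le_trans := hle.trans
        le_antisymm := hle.antisymm
        le_total := hle.total
        toDecidableLE := Classical.decRel _ }
    exact Set.exists_min_image (φ a) id (Set.toFinite _) ⟨c, hc⟩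
  choose m hm hmle using hmin
  have hminj : Function.Injective m := fun a b hab ↦ by
    by_contra hne
    exact Set.disjoint_left.1 (hdisj hne) (hm a) (hab ▸ hm b)
  have key : ∀ a b, H.Adj a b → le (m a) (m b) → m a ∈ WReach G le (4 * r + 1) (m b) := by
    intro a b hab hlab
    obtain ⟨u, hu, v, hv, huv⟩ := hadj a b hab
    obtain ⟨p, hp, hps⟩ := (hrad a).exists_walk (hm a) hu
    obtain ⟨q, hq, hqs⟩ := (hrad b).exists_walk hv (hm b)
    let t := p.append (Walk.cons huv q)
    have ht : ∀ x ∈ t.support, le (m a) x := by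
      intro x hx
      rcases (Walk.mem_support_append_iff ..).1 hx with hx | hx
      · exact hmle a x (hps x hx)
      · rcases List.mem_cons.1 (by simpa using hx) with rfl | hx
        · exact hmle a _ hu
        · exact hle.trans _ _ _ hlab (hmle b x (hqs x hx))
    refine ⟨hlab, t.bypass, t.bypass_isPath, t.length_bypass_le_length.trans ?_, ?_⟩
    · simp only [t, Walk.length_append, Walk.length_cons]
      omega
    · exact fun x hx hxa _ ↦ ⟨ht x (t.support_bypass_subset_support hx), hxa.symm⟩
  let F : Finset (Σ _ : Fin n, Fin n) :=
    Finset.univ.sigma fun b ↦ Finset.univ.filter fun a ↦ m a ∈ WReach G le (4 * r + 1) (m b)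
  have hF : F.card ≤ wcol G (4 * r + 1) * n := by
    rw [Finset.card_sigma]
    refine (Finset.sum_le_card_nsmul _ _ (wcol G (4 * r + 1)) fun b _ ↦ ?_).trans
      (by simp [mul_comm])
    refine le_trans ?_ (hw (m b))
    rw [← Set.ncard_coe_finset, ← Set.ncard_image_of_injective _ hminj]
    refine Set.ncard_le_ncard ?_
    rintro _ ⟨a, ha, rfl⟩
    simpa using ha
  refine le_trans ?_ hF
  rw [← Set.ncard_coe_finset]
  refine (Set.ncard_le_ncard (t := (fun e : Σ _ : Fin n, Fin n ↦ s(e.1, e.2)) '' F) ?_).trans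
    (Set.ncard_image_le)
  intro e he
  induction e using Sym2.ind with
  | _ a b =>
    rcases hle.total (m a) (m b) with hab | hab
    · exact ⟨⟨b, a⟩, by simpa [F] using key a b he hab, Sym2.eq_swap⟩
    · exact ⟨⟨a, b⟩, by simpa [F] using key b a he.symm hab, rfl⟩

end Orders

end SimpleGraph

/-- A class has bounded expansion iff for every `r` the weak
`r`-coloring numbers of its members are uniformly bounded. -/
theorem stmt9 (C : Set FGraph) :
    BoundedExpansion C ↔ ∀ r : ℕ, ∃ w : ℕ, ∀ G ∈ C, wcol G.G r ≤ w := by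

  constructor
  · intro h r
    obtain ⟨d, hd⟩ := h (2 * r)
    refine ⟨_, fun G hG ↦ wcol_le_of_sparse_minors (D := ⌈d⌉₊) fun n H hH ↦ ?_⟩
    have hdens := hd G hG n H hH
    rcases n.eq_zero_or_pos with rfl | hn
    · have : H = ⊥ := Subsingleton.elim _ _
      simp [this]
    · rw [div_le_iff₀ (by exact_mod_cast hn)] at hdens
      have : d * n ≤ (⌈d⌉₊ : ℝ) * n := by
        gcongr
        exact Nat.le_ceil d
      exact_mod_cast hdens.trans this
  · intro h r
    obtain ⟨w, hw⟩ := h (4 * r + 1)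
    refine ⟨w, fun G hG n H hH ↦ div_le_of_le_mul₀ (by positivity) (by positivity) ?_⟩
    exact_mod_cast (IsDepthMinor.card_edgeSet_le hH).trans (Nat.mul_le_mul_right _ (hw G hG))
end

section
/- A class 𝒞 of graphs is nowhere dense if and only if for every r ∈ ℕ and every real ε > 0 there exists a number w = w(r,ε) such that wcol_r(H) ≤ w·|V(H)|^ε for every subgraph H of every G ∈ 𝒞. -/
open SimpleGraph

variable {V : Type} {W : Type}

/-- `y` can be reached from `x` by a walk of length at most `j` staying inside `A`. -/
def ReachIn (G : SimpleGraph V) (A : Set V) (j : ℕ) (x y : V) : Prop :=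
  ∃ p : G.Walk x y, p.length ≤ j ∧ ∀ z ∈ p.support, z ∈ A

namespace ReachIn

variable {G : SimpleGraph V} {A B : Set V} {i j : ℕ} {x y z : V}

theorem refl (hx : x ∈ A) : ReachIn G A j x x :=
  ⟨.nil, by simp, by simpa using hx⟩

theorem mono (h : ReachIn G A i x y) (hij : i ≤ j) (hAB : A ⊆ B) : ReachIn G B j x y := by
  obtain ⟨p, hp, hA⟩ := h
  exact ⟨p, hp.trans hij, fun z hz => hAB (hA z hz)⟩

theorem left_mem (h : ReachIn G A j x y) : x ∈ A := by
  obtain ⟨p, -, hA⟩ := h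
  exact hA _ p.start_mem_support

theorem right_mem (h : ReachIn G A j x y) : y ∈ A := by
  obtain ⟨p, -, hA⟩ := h
  exact hA _ p.end_mem_support

theorem symm (h : ReachIn G A j x y) : ReachIn G A j y x := by
  obtain ⟨p, hp, hA⟩ := h
  exact ⟨p.reverse, by simpa using hp, by simpa using hA⟩

theorem trans (h : ReachIn G A i x y) (h' : ReachIn G A j y z) : ReachIn G A (i + j) x z := by
  obtain ⟨p, hp, hA⟩ := h
  obtain ⟨q, hq, hB⟩ := h'
  refine ⟨p.append q, by simp; lia, fun w hw => ?_⟩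
  rcases (SimpleGraph.Walk.mem_support_append_iff p q).1 hw with hw | hw
  exacts [hA w hw, hB w hw]

theorem of_adj (h : G.Adj x y) (hx : x ∈ A) (hy : y ∈ A) : ReachIn G A 1 x y :=
  ⟨.cons h .nil, by simp, by simp [hx, hy]⟩

end ReachIn

theorem hasRadiusLE_induce_iff {G : SimpleGraph V} {A : Set V} {r : ℕ} :
    hasRadiusLE (G.induce A) r ↔ ∃ c ∈ A, ∀ x ∈ A, ReachIn G A r c x := by
  constructor
  · rintro ⟨c, hc⟩
    refine ⟨c, c.2, fun x hx => ?_⟩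
    obtain ⟨p, hp⟩ := hc ⟨x, hx⟩
    refine ⟨p.map (Embedding.induce A).toHom, (Walk.length_map _ _).trans_le hp, fun z hz => ?_⟩
    erw [Walk.support_map] at hz
    obtain ⟨y, -, rfl⟩ := List.mem_map.1 hz
    exact y.2
  · rintro ⟨c, hc, h⟩
    refine ⟨⟨c, hc⟩, fun x => ?_⟩
    obtain ⟨p, hp, hA⟩ := h x x.2
    refine ⟨p.induce A hA, ?_⟩
    have := congrArg Walk.length (p.map_induce hA)
    rw [Walk.length_map] at this
    exact this.trans_le hp

theorem IsDepthMinor.mono_depth {r s : ℕ} {H : SimpleGraph W} {G : SimpleGraph V}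
    (h : IsDepthMinor r H G) (hrs : r ≤ s) : IsDepthMinor s H G := by
  obtain ⟨φ, hr, hd, he⟩ := h
  refine ⟨φ, fun w => ?_, hd, he⟩
  obtain ⟨c, hc⟩ := hr w
  exact ⟨c, fun v => (hc v).imp fun p hp => hp.trans hrs⟩

theorem IsDepthMinor.comp_hom {W' : Type} {r : ℕ} {H : SimpleGraph W} {H' : SimpleGraph W'}
    {G : SimpleGraph V} (h : IsDepthMinor r H G) (f : W' → W) (hf : Function.Injective f)
    (hadj : ∀ a b, H'.Adj a b → H.Adj (f a) (f b)) : IsDepthMinor r H' G := by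
  obtain ⟨φ, hr, hd, he⟩ := h
  exact ⟨φ ∘ f, fun w => hr _, fun a b hab => hd (hf.ne hab), fun a b hab => he _ _ (hadj a b hab)⟩

/-- Every branch set of a depth-`a` minor of a depth-`b` minor has radius at most
`(2 * b + 1) * a + b`. -/
theorem IsDepthMinor.trans {U : Type} {a b : ℕ} {H : SimpleGraph W} {K : SimpleGraph U}
    {G : SimpleGraph V} (h : IsDepthMinor a H K) (h' : IsDepthMinor b K G) :
    IsDepthMinor ((2 * b + 1) * a + b) H G := by
  obtain ⟨ψ, hr, hd, he⟩ := h
  obtain ⟨χ, hr', hd', he'⟩ := h'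
  simp only [hasRadiusLE_induce_iff] at hr hr'
  choose c hc hcr using hr'
  refine ⟨fun w => ⋃ x ∈ ψ w, χ x, fun w => ?_, fun w w' hw => ?_, fun w w' hw => ?_⟩
  · rw [hasRadiusLE_induce_iff]
    obtain ⟨d, hdw, hdr⟩ := hr w
    have hsub : ∀ x ∈ ψ w, χ x ⊆ ⋃ x ∈ ψ w, χ x := fun x hx => Set.subset_biUnion_of_mem hx
    have key : ∀ (x y : U) (p : K.Walk x y), (∀ z ∈ p.support, z ∈ ψ w) →
        ReachIn G (⋃ x ∈ ψ w, χ x) ((2 * b + 1) * p.length) (c x) (c y) := by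
      intro x y p
      induction p with
      | nil => exact fun hp => .refl (hsub _ (hp _ (by simp)) (hc _))
      | @cons x y z hxy p ih =>
        intro hp
        have hx : x ∈ ψ w := hp _ (by simp)
        have hy : y ∈ ψ w := hp _ (by simp)
        obtain ⟨u, hu, v, hv, huv⟩ := he' _ _ hxy
        have h1 := ((hcr x u hu).mono le_rfl (hsub x hx)).trans
          (.of_adj huv (hsub x hx hu) (hsub y hy hv))
        have h2 := h1.trans (((hcr y v hv).symm).mono le_rfl (hsub y hy))
        refine (h2.trans (ih fun z hz => hp z (by simp [hz]))).mono ?_ subset_rfl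
        rw [Walk.length_cons]
        ring_nf
        lia
    refine ⟨c d, hsub d hdw (hc d), fun v hv => ?_⟩
    obtain ⟨x, hx, hvx⟩ := Set.mem_iUnion₂.1 hv
    obtain ⟨p, hp, hpA⟩ := hdr x hx
    refine ((key d x p hpA).trans ((hcr x v hvx).mono le_rfl (hsub x hx))).mono ?_ subset_rfl
    gcongr
  · simp only [Set.disjoint_iUnion_left, Set.disjoint_iUnion_right]
    intro x hx y hy
    exact hd' fun hxy => (hd hw).ne_of_mem hy hx hxy
  · obtain ⟨x, hx, y, hy, hxy⟩ := he w w' hw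
    obtain ⟨u, hu, v, hv, huv⟩ := he' _ _ hxy
    exact ⟨u, Set.mem_biUnion hx hu, v, Set.mem_biUnion hy hv, huv⟩

open scoped Classical in
/-- Every nonempty subset `U` of `S` has a vertex with at most `D` neighbors in `U`. -/
def DegenerateOn (H : SimpleGraph V) (S : Finset V) (D : ℕ) : Prop :=
  ∀ U ⊆ S, U.Nonempty → ∃ u ∈ U, (U.filter (H.Adj u)).card ≤ D

open scoped Classical in
theorem DegenerateOn.card_adj_le {H : SimpleGraph V} {S : Finset V} {D : ℕ}
    (h : DegenerateOn H S D) :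
    ((S ×ˢ S).filter fun p => H.Adj p.1 p.2).card ≤ 2 * D * S.card := by
  induction hn : S.card generalizing S with
  | zero => simp [Finset.card_eq_zero.1 hn]
  | succ n ih =>
    obtain ⟨u, hu, hd⟩ := h S subset_rfl (Finset.card_pos.1 (by lia))
    have hc : (S.erase u).card = n := by rw [Finset.card_erase_of_mem hu, hn]; rfl
    have h1 := ih (S := S.erase u) (fun U hU => h U (hU.trans (Finset.erase_subset _ _))) hc
    have hsub : ((S ×ˢ S).filter fun p => H.Adj p.1 p.2) ⊆
        (((S.erase u) ×ˢ (S.erase u)).filter fun p => H.Adj p.1 p.2) ∪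
          ((S.filter (H.Adj u)).image (fun w => (u, w)) ∪
            (S.filter (H.Adj u)).image (fun w => (w, u))) := by
      rintro ⟨a, b⟩ hab
      simp only [Finset.mem_filter, Finset.mem_product] at hab
      obtain ⟨⟨ha, hb⟩, hab⟩ := hab
      simp only [Finset.mem_union, Finset.mem_filter, Finset.mem_product, Finset.mem_erase,
        Finset.mem_image, Prod.mk.injEq]
      by_cases hau : a = u
      · subst hau
        exact .inr (.inl ⟨b, ⟨hb, hab⟩, rfl, rfl⟩)
      by_cases hbu : b = u
      · subst hbu
        exact .inr (.inr ⟨a, ⟨ha, hab.symm⟩, rfl, rfl⟩)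
      exact .inl ⟨⟨⟨hau, ha⟩, hbu, hb⟩, hab⟩
    have h2 := (Finset.card_le_card hsub).trans ((Finset.card_union_le _ _).trans
      (add_le_add_right (Finset.card_union_le _ _) _))
    have h3 := Finset.card_image_le (s := S.filter (H.Adj u)) (f := fun w => (u, w))
    have h4 := Finset.card_image_le (s := S.filter (H.Adj u)) (f := fun w => (w, u))
    rw [mul_add]
    lia

open scoped Classical in
theorem DegenerateOn.card_le_of_forall_adj {H : SimpleGraph V} {S : Finset V} {D : ℕ}
    (h : DegenerateOn H S D) {P : Finset (V × V)}
    (hP : ∀ e ∈ P, e.1 ∈ S ∧ e.2 ∈ S ∧ H.Adj e.1 e.2) : P.card ≤ 2 * D * S.card := by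
  refine (Finset.card_le_card fun e he => ?_).trans h.card_adj_le
  rw [Finset.mem_filter, Finset.mem_product]
  exact ⟨⟨(hP e he).1, (hP e he).2.1⟩, (hP e he).2.2⟩

open scoped Classical in
theorem DegenerateOn.exists_independent {H : SimpleGraph V} {S : Finset V} {D : ℕ}
    (h : DegenerateOn H S D) :
    ∃ R ⊆ S, (∀ a ∈ R, ∀ b ∈ R, ¬ H.Adj a b) ∧ S.card ≤ (D + 1) * R.card := by
  induction hn : S.card using Nat.strong_induction_on generalizing S with
  | _ n ih =>
    rcases S.eq_empty_or_nonempty with rfl | hS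
    · exact ⟨∅, by simp, by simp, by simp at hn; simp [← hn]⟩
    obtain ⟨u, hu, hd⟩ := h S subset_rfl hS
    set N := S.filter (H.Adj u)
    set S' := (S.erase u) \ N
    have hS' : S' ⊆ S := Finset.sdiff_subset.trans (Finset.erase_subset _ _)
    have hlt : S'.card < n := by
      rw [← hn]
      refine Finset.card_lt_card ⟨hS', fun hh => ?_⟩
      have := hh hu
      simp [S'] at this
    have hle : n ≤ S'.card + N.card + 1 := by
      have := Finset.le_card_sdiff N (S.erase u)
      rw [Finset.card_erase_of_mem hu] at this
      lia
    obtain ⟨R, hR, hind, hcard⟩ := ih _ hlt (S := S') (fun U hU => h U (hU.trans hS')) rfl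
    have huR : u ∉ R := fun hh => by simpa [S'] using hR hh
    have hnon : ∀ a ∈ R, ¬ H.Adj u a := fun a ha hua => by
      have := hR ha
      simp only [S', N, Finset.mem_sdiff, Finset.mem_filter, not_and] at this
      exact this.2 (hS' (hR ha)) hua
    refine ⟨insert u R, Finset.insert_subset hu (hR.trans hS'), fun a ha b hb => ?_, ?_⟩
    · rcases Finset.mem_insert.1 ha with rfl | ha' <;> rcases Finset.mem_insert.1 hb with rfl | hb'
      · exact H.irrefl
      · exact hnon b hb'
      · exact fun hh => hnon a ha' hh.symm
      · exact hind a ha' b hb'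
    · rw [Finset.card_insert_of_notMem huR, mul_add]
      lia

open scoped Classical in
/-- In a graph of minimum degree at least `d` there is a set of about `t / d` of the vertices such
that a positive fraction of the other vertices have at least `t` neighbors in it. -/
theorem exists_multiply_dominating {H : SimpleGraph V} {U : Finset V} {d t : ℕ} (ht : 1 ≤ t)
    (htd : 16 * t ≤ d) (hdeg : ∀ u ∈ U, d ≤ (U.filter (H.Adj u)).card) :
    ∃ A ⊆ U, d * A.card ≤ 4 * t * U.card ∧
      U.card ≤ 4 * ((U \ A).filter fun x => t ≤ (A.filter (H.Adj x)).card).card := by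
  let Φ : Finset V → ℤ := fun A =>
    4 * ((∑ x ∈ U, min t (A.filter (H.Adj x)).card : ℕ) : ℤ) - d * A.card
  obtain ⟨A, hA, hmax⟩ := U.powerset.exists_max_image Φ ⟨∅, by simp⟩
  have hAU : A ⊆ U := Finset.mem_powerset.1 hA
  have hcard : d * A.card ≤ 4 * t * U.card := by
    have h1 := hmax ∅ (by simp)
    have h2 : (∑ x ∈ U, min t (A.filter (H.Adj x)).card) ≤ U.card * t :=
      Finset.sum_le_card_nsmul _ _ _ fun x _ => min_le_left _ _
    simp only [Φ, Finset.filter_empty, Finset.card_empty, Nat.zero_le, min_eq_right,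
      Finset.sum_const_zero] at h1
    zify at h2 ⊢
    push_cast at h1
    linarith
  refine ⟨A, hAU, hcard, ?_⟩
  set B := U.filter fun x => (A.filter (H.Adj x)).card < t with hB
  have hgain : ∀ a ∈ U \ A, 4 * (B.filter fun x => H.Adj x a).card ≤ d := by
    intro a ha
    obtain ⟨haU, haA⟩ := Finset.mem_sdiff.1 ha
    have h1 := hmax (insert a A) (Finset.mem_powerset.2 (Finset.insert_subset haU hAU))
    have h2 : ∑ x ∈ U, min t ((insert a A).filter (H.Adj x)).card =
        ∑ x ∈ U, min t (A.filter (H.Adj x)).card + (B.filter fun x => H.Adj x a).card := by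
      rw [hB, Finset.filter_filter, Finset.card_filter, ← Finset.sum_add_distrib]
      refine Finset.sum_congr rfl fun x _ => ?_
      by_cases hxa : H.Adj x a
      · rw [Finset.filter_insert, if_pos hxa, Finset.card_insert_of_notMem (by simp [haA])]
        simp only [hxa, and_true]
        split_ifs <;> lia
      · rw [Finset.filter_insert, if_neg hxa]
        simp [hxa]
    simp only [Φ] at h1
    rw [h2, Finset.card_insert_of_notMem haA] at h1
    push_cast at h1
    zify
    linarith
  have hdouble := Finset.sum_card_bipartiteAbove_eq_sum_card_bipartiteBelow (s := B) (t := U \ A)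
    H.Adj
  have hlow : B.card * (d - t) ≤ ∑ x ∈ B, ((U \ A).filter (H.Adj x)).card := by
    refine Finset.card_nsmul_le_sum _ _ _ fun x hx => ?_
    obtain ⟨hxU, hxt⟩ := Finset.mem_filter.1 hx
    have h1 := hdeg x hxU
    have h2 : (U.filter (H.Adj x)) ⊆ (U \ A).filter (H.Adj x) ∪ A.filter (H.Adj x) := by
      intro y hy
      simp only [Finset.mem_filter, Finset.mem_union, Finset.mem_sdiff] at hy ⊢
      tauto
    have h3 := (Finset.card_le_card h2).trans (Finset.card_union_le _ _)
    lia
  have hup : 4 * ∑ a ∈ U \ A, (B.filter fun x => H.Adj x a).card ≤ U.card * d := by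
    rw [Finset.mul_sum]
    exact (Finset.sum_le_card_nsmul _ _ d hgain).trans
      (Nat.mul_le_mul_right _ (Finset.card_le_card Finset.sdiff_subset))
  have hBd : 4 * (B.card * (d - t)) ≤ U.card * d :=
    (Nat.mul_le_mul_left 4 hlow).trans (hdouble ▸ hup)
  have hcover : U ⊆ A ∪ (B ∪ (U \ A).filter fun x => t ≤ (A.filter (H.Adj x)).card) := by
    intro x hx
    simp only [hB, Finset.mem_union, Finset.mem_filter, Finset.mem_sdiff]
    have := lt_or_ge (A.filter (H.Adj x)).card t
    tauto
  have hle := (Finset.card_le_card hcover).trans ((Finset.card_union_le _ _).trans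
    (add_le_add_right (Finset.card_union_le _ _) _))
  have hA4 : 4 * A.card ≤ U.card := by
    refine Nat.le_of_mul_le_mul_left (?_ : 4 * t * (4 * A.card) ≤ 4 * t * U.card) (by lia)
    calc 4 * t * (4 * A.card) = 16 * t * A.card := by ring
      _ ≤ d * A.card := Nat.mul_le_mul_right _ htd
      _ ≤ _ := hcard
  have hB15 : 15 * B.card ≤ 4 * U.card := by
    have hd : 0 < d := by lia
    refine Nat.le_of_mul_le_mul_right (?_ : 15 * B.card * d ≤ 4 * U.card * d) hd
    have h1 : 15 * d ≤ 16 * (d - t) := by lia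
    calc 15 * B.card * d = B.card * (15 * d) := by ring
      _ ≤ B.card * (16 * (d - t)) := Nat.mul_le_mul_left _ h1
      _ = 4 * (4 * (B.card * (d - t))) := by ring
      _ ≤ 4 * (U.card * d) := Nat.mul_le_mul_left _ hBd
      _ = _ := by ring
  lia

/-- The graph with an edge joining `f x` and `g x` for every `x ∈ X`. -/
def pairGraph (f g : V → V) (X : Finset V) : SimpleGraph V :=
  SimpleGraph.fromRel fun a b => ∃ x ∈ X, f x = a ∧ g x = b

theorem isDepthMinor_pairGraph {H : SimpleGraph V} {U A X : Finset V} {f g : V → V} (hA : A ⊆ U)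
    (hX : X ⊆ U) (hAX : Disjoint A X) (hf : ∀ x ∈ X, H.Adj x (f x))
    (hg : ∀ x ∈ X, H.Adj x (g x)) :
    IsDepthMinor 1 ((pairGraph f g X).induce (A : Set V)) (H.induce (U : Set V)) := by
  have hAX' : ∀ a ∈ A, a ∉ X := fun a ha hx => Finset.disjoint_left.1 hAX ha hx
  refine ⟨fun a => {y | (y : V) = a ∨ (y : V) ∈ X ∧ f y = a}, fun a => ?_, fun a b hab => ?_,
    fun a b hab => ?_⟩
  · rw [hasRadiusLE_induce_iff]
    refine ⟨⟨a, hA a.2⟩, .inl rfl, fun y hy => ?_⟩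
    rcases hy with hy | ⟨hy, hfy⟩
    · obtain rfl : (⟨a, hA a.2⟩ : {x // x ∈ (U : Set V)}) = y := Subtype.ext hy.symm
      exact .refl (.inl rfl)
    · refine .of_adj ?_ (.inl rfl) (.inr ⟨hy, hfy⟩)
      change H.Adj a y
      rw [← hfy]
      exact (hf y hy).symm
  · refine Set.disjoint_left.2 ?_
    rintro y (hy | ⟨hy, hfy⟩) (hy' | ⟨hy', hfy'⟩)
    · exact hab (Subtype.ext (hy.symm.trans hy'))
    · exact hAX' _ (hy ▸ a.2) hy'
    · exact hAX' _ (hy' ▸ b.2) hy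
    · exact hab (Subtype.ext (hfy.symm.trans hfy'))
  · have hab' : (pairGraph f g X).Adj a b := hab
    obtain ⟨-, ⟨x, hx, hfx, hgx⟩ | ⟨x, hx, hfx, hgx⟩⟩ := (SimpleGraph.fromRel_adj _ _ _).1 hab'
    · exact ⟨⟨x, hX hx⟩, .inr ⟨hx, hfx⟩, ⟨b, hA b.2⟩, .inl rfl,
        show H.Adj x b from hgx ▸ hg x hx⟩
    · exact ⟨⟨a, hA a.2⟩, .inl rfl, ⟨x, hX hx⟩, .inr ⟨hx, hfx⟩,
        show H.Adj a x from hgx ▸ (hg x hx).symm⟩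

open scoped Classical in
theorem exists_pairGraph {H : SimpleGraph V} {U A X : Finset V} {t : ℕ} (hA : A ⊆ U)
    (hX : X ⊆ U) (hAX : Disjoint A X) (ht : ∀ x ∈ X, t ≤ (A.filter (H.Adj x)).card)
    (hK : ¬ IsDepthMinor 1 (⊤ : SimpleGraph (Fin t)) (H.induce (U : Set V))) :
    ∃ f g : V → V, (∀ x ∈ X, f x ∈ A ∧ H.Adj x (f x)) ∧ (∀ x ∈ X, g x ∈ A ∧ H.Adj x (g x)) ∧
      (∀ x ∈ X, f x ≠ g x) ∧ ∀ x ∈ X, ∀ y ∈ X, f x = f y → g x = g y → x = y := by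
  induction X using Finset.induction_on with
  | empty => exact ⟨id, id, by simp, by simp, by simp, by simp⟩
  | @insert x X hx ih =>
    obtain ⟨f, g, hf, hg, hne, hinj⟩ := ih ((Finset.subset_insert _ _).trans hX)
      (hAX.mono_right (Finset.subset_insert _ _)) fun y hy => ht y (Finset.mem_insert_of_mem hy)
    have hminor := isDepthMinor_pairGraph (f := f) (g := g) hA
      ((Finset.subset_insert x X).trans hX) (hAX.mono_right (Finset.subset_insert _ _))
      (fun y hy => (hf y hy).2) fun y hy => (hg y hy).2
    obtain ⟨T, hT, hTt⟩ := Finset.exists_subset_card_eq (ht x (Finset.mem_insert_self _ _))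
    obtain ⟨a, ha, b, hb, hab, hnadj⟩ :
        ∃ a ∈ T, ∃ b ∈ T, a ≠ b ∧ ¬ (pairGraph f g X).Adj a b := by
      by_contra! hcon
      refine hK (hminor.comp_hom
        (fun i => ⟨(T.equivFinOfCardEq hTt).symm i, (Finset.mem_filter.1 (hT (Subtype.prop _))).1⟩)
        (fun i j hij => ?_) fun i j hij => ?_)
      · have := congrArg Subtype.val hij
        exact (T.equivFinOfCardEq hTt).symm.injective (Subtype.ext this)
      · exact hcon _ (Subtype.prop _) _ (Subtype.prop _) fun hh =>
          hij.ne ((T.equivFinOfCardEq hTt).symm.injective (Subtype.ext hh))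
    have hne' : ∀ y ∈ X, y ≠ x := fun y hy hyx => hx (hyx ▸ hy)
    have haA := Finset.mem_filter.1 (hT ha)
    have hbA := Finset.mem_filter.1 (hT hb)
    have hnew : ∀ y ∈ X, a = f y → b = g y → False := fun y hy hay hby =>
      hnadj ((SimpleGraph.fromRel_adj _ _ _).2 ⟨hab, .inl ⟨y, hy, hay.symm, hby.symm⟩⟩)
    refine ⟨Function.update f x a, Function.update g x b, ?_, ?_, ?_, ?_⟩
    · intro y hy
      rcases Finset.mem_insert.1 hy with rfl | hy
      · simpa using haA
      · simpa [hne' y hy] using hf y hy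
    · intro y hy
      rcases Finset.mem_insert.1 hy with rfl | hy
      · simpa using hbA
      · simpa [hne' y hy] using hg y hy
    · intro y hy
      rcases Finset.mem_insert.1 hy with rfl | hy
      · simpa using hab
      · simpa [hne' y hy] using hne y hy
    · intro y hy z hz
      rcases Finset.mem_insert.1 hy with rfl | hy' <;> rcases Finset.mem_insert.1 hz with rfl | hz'
      · simp
      · simp only [Function.update_self, Function.update_of_ne (hne' z hz')]
        exact fun h1 h2 => (hnew z hz' h1 h2).elim
      · simp only [Function.update_self, Function.update_of_ne (hne' y hy')]
        exact fun h1 h2 => (hnew y hy' h1.symm h2.symm).elim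
      · simp only [Function.update_of_ne (hne' y hy'), Function.update_of_ne (hne' z hz')]
        exact hinj y hy' z hz'

open scoped Classical in
/-- A graph of minimum degree `d` without a shallow clique minor has a depth-`1` minor with only
`O(n / d)` vertices and minimum degree `Ω(d)`. -/
theorem exists_denser_minor {H : SimpleGraph V} {U : Finset V} {d t : ℕ} (ht : 1 ≤ t)
    (htd : 16 * t ≤ d) (hU : U.Nonempty) (hdeg : ∀ u ∈ U, d ≤ (U.filter (H.Adj u)).card)
    (hK : ¬ IsDepthMinor 1 (⊤ : SimpleGraph (Fin t)) (H.induce (U : Set V))) :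
    ∃ (H' : SimpleGraph V) (U' : Finset V), U'.Nonempty ∧
      IsDepthMinor 1 (H'.induce (U' : Set V)) (H.induce (U : Set V)) ∧
      d * U'.card ≤ 4 * t * U.card ∧
      ∀ u ∈ U', (d - 1) / (32 * t) + 1 ≤ (U'.filter (H'.Adj u)).card := by
  obtain ⟨A, hA, hAcard, hXcard⟩ := exists_multiply_dominating ht htd hdeg
  set X := (U \ A).filter fun x => t ≤ (A.filter (H.Adj x)).card
  have hXU : X ⊆ U := (Finset.filter_subset _ _).trans Finset.sdiff_subset
  have hAX : Disjoint A X := Finset.disjoint_left.2 fun a ha hx =>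
    (Finset.mem_sdiff.1 (Finset.mem_filter.1 hx).1).2 ha
  obtain ⟨f, g, hf, hg, hne, hinj⟩ := exists_pairGraph hA hXU hAX
    (fun x hx => (Finset.mem_filter.1 hx).2) hK
  have hminor := isDepthMinor_pairGraph hA hXU hAX (fun y hy => (hf y hy).2)
    fun y hy => (hg y hy).2
  set D := (d - 1) / (32 * t)
  have hnd : ¬ DegenerateOn (pairGraph f g X) A D := by
    intro hD
    have h1 := hD.card_adj_le
    have h2 : X.card ≤ ((A ×ˢ A).filter fun p => (pairGraph f g X).Adj p.1 p.2).card := by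
      refine Finset.card_le_card_of_injOn (fun x => (f x, g x)) (fun x hx => ?_)
        fun x hx y hy hxy => ?_
      · simp only [Finset.coe_filter, Finset.mem_product, Set.mem_ofPred_eq]
        exact ⟨⟨(hf x hx).1, (hg x hx).1⟩, (SimpleGraph.fromRel_adj _ _ _).2
          ⟨hne x hx, .inl ⟨x, hx, rfl, rfl⟩⟩⟩
      · exact hinj x hx y hy (congrArg Prod.fst hxy) (congrArg Prod.snd hxy)
    have h3 : U.card ≤ 8 * D * A.card := by linarith
    have h4 : 32 * t * D ≤ d - 1 := Nat.mul_div_le _ _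
    have h5 : d * U.card ≤ (d - 1) * U.card := calc
      d * U.card ≤ d * (8 * D * A.card) := Nat.mul_le_mul_left _ h3
      _ = 8 * D * (d * A.card) := by ring
      _ ≤ 8 * D * (4 * t * U.card) := Nat.mul_le_mul_left _ hAcard
      _ = 32 * t * D * U.card := by ring
      _ ≤ _ := Nat.mul_le_mul_right _ h4
    have := Nat.le_of_mul_le_mul_right h5 hU.card_pos
    lia
  simp only [DegenerateOn, not_forall, not_exists, not_and, not_le] at hnd
  obtain ⟨U', hU', hne', hdeg'⟩ := hnd
  refine ⟨pairGraph f g X, U', hne', ?_, ?_, hdeg'⟩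
  · exact hminor.comp_hom (fun u => ⟨u, hU' u.2⟩)
      (fun a b hab => Subtype.ext (Subtype.mk.inj hab)) fun a b hab => hab
  · exact (Nat.mul_le_mul_left _ (Finset.card_le_card hU')).trans hAcard

open scoped Classical in
/-- For every `k` there is a depth `s` such that a graph on `n` vertices with minimum degree of
order `n ^ (1 / k)` contains every fixed complete graph as a depth-`s` minor. -/
theorem exists_isDepthMinor_top_of_le_degree (k : ℕ) : ∃ s : ℕ, ∀ t : ℕ, 1 ≤ t → ∃ c : ℕ, 1 ≤ c ∧
    ∀ (V : Type) (H : SimpleGraph V) (U : Finset V) (d : ℕ), U.Nonempty →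
      (∀ u ∈ U, d ≤ (U.filter (H.Adj u)).card) → c * U.card ≤ d ^ k →
      IsDepthMinor s (⊤ : SimpleGraph (Fin t)) (H.induce (U : Set V)) := by
  induction k with
  | zero =>
    refine ⟨0, fun t _ => ⟨2, by simp, fun V H U d hU _ h => ?_⟩⟩
    have := hU.card_pos
    rw [pow_zero] at h
    lia
  | succ k ih =>
    obtain ⟨s, hs⟩ := ih
    refine ⟨(2 * 1 + 1) * s + 1, fun t ht => ?_⟩
    obtain ⟨c, hc, hcs⟩ := hs t ht
    refine ⟨c * (4 * t) * (32 * t) ^ k, Nat.one_le_iff_ne_zero.2 (by positivity), ?_⟩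
    intro V H U d hU hdeg h
    by_cases hK : IsDepthMinor 1 (⊤ : SimpleGraph (Fin t)) (H.induce (U : Set V))
    · exact hK.mono_depth (by lia)
    have hdU : d ≤ U.card := by
      obtain ⟨u, hu⟩ := hU
      exact (hdeg u hu).trans (Finset.card_le_card (Finset.filter_subset _ _))
    have htd : 16 * t ≤ d := by
      by_contra! hlt
      have h1 : d ^ (k + 1) ≤ (32 * t) ^ k * U.card := by
        rw [pow_succ]
        exact Nat.mul_le_mul (Nat.pow_le_pow_left (by lia) k) hdU
      have h2 : 4 * ((32 * t) ^ k * U.card) ≤ c * (4 * t) * (32 * t) ^ k * U.card := by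
        rw [mul_assoc (c * (4 * t))]
        exact Nat.mul_le_mul_right _ (by nlinarith)
      have h3 : 0 < (32 * t) ^ k * U.card := Nat.mul_pos (by positivity) hU.card_pos
      lia
    obtain ⟨H', U', hU', hminor, hcard, hdeg'⟩ := exists_denser_minor ht htd hU hdeg hK
    refine (hcs V H' U' _ hU' hdeg' ?_).trans hminor
    set d' := (d - 1) / (32 * t) + 1
    have hd' : d ≤ d' * (32 * t) := by
      have := Nat.lt_div_mul_add (a := d - 1) (b := 32 * t) (by lia)
      simp only [d', add_mul, one_mul]
      lia
    refine Nat.le_of_mul_le_mul_right (?_ : _ * (d * (32 * t) ^ k) ≤ _ * (d * (32 * t) ^ k))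
      (Nat.mul_pos (by lia) (by positivity))
    calc c * U'.card * (d * (32 * t) ^ k) = c * (32 * t) ^ k * (d * U'.card) := by ring
      _ ≤ c * (32 * t) ^ k * (4 * t * U.card) := Nat.mul_le_mul_left _ hcard
      _ = c * (4 * t) * (32 * t) ^ k * U.card := by ring
      _ ≤ d ^ (k + 1) := h
      _ = d * d ^ k := by ring
      _ ≤ d * (d' * (32 * t)) ^ k := Nat.mul_le_mul_left _ (Nat.pow_le_pow_left hd' k)
      _ = d' ^ k * (d * (32 * t) ^ k) := by rw [mul_pow]; ring

open scoped Classical in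
/-- The vertices of `T` other than `v` adjacent to a vertex reachable from `v` in at most `r`
steps outside of `T`. -/
noncomputable def reachBoundary (G : SimpleGraph V) (T : Finset V) (r : ℕ) (v : V) : Finset V :=
  T.filter fun y => y ≠ v ∧ ∃ x, ReachIn G ((T : Set V)ᶜ ∪ {v}) r v x ∧ G.Adj x y

theorem mem_reachBoundary {G : SimpleGraph V} {T : Finset V} {r : ℕ} {v y : V} :
    y ∈ reachBoundary G T r v ↔
      y ∈ T ∧ y ≠ v ∧ ∃ x, ReachIn G ((T : Set V)ᶜ ∪ {v}) r v x ∧ G.Adj x y := by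
  simp [reachBoundary]

/-- A walk from `v` to `T` passes through the boundary of `v`. -/
theorem ReachIn.exists_mem_reachBoundary {G : SimpleGraph V} {T : Finset V} {A : Set V}
    {l r : ℕ} {v u : V} (h : ReachIn G A l v u) (hl : l ≤ r) (hu : u ∈ T) (huv : u ≠ v) :
    ∃ z ∈ reachBoundary G T r v, ReachIn G A (l - 1) z u := by
  have key : ∀ (x u : V) (p : G.Walk x u) (j : ℕ), (∀ z ∈ p.support, z ∈ A) →
      j + p.length ≤ r → ReachIn G ((T : Set V)ᶜ ∪ {v}) j v x → u ∈ T → u ≠ v →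
      ∃ z ∈ reachBoundary G T r v, ReachIn G A (p.length - 1) z u := by
    intro x u p
    induction p with
    | nil =>
      intro j _ _ hx hu huv
      rcases hx.right_mem with hx | hx
      exacts [(hx hu).elim, (huv hx).elim]
    | @cons x y u hxy p ih =>
      intro j hA hj hx hu huv
      rw [Walk.length_cons] at hj
      by_cases hy : y ∈ T ∧ y ≠ v
      · refine ⟨y, mem_reachBoundary.2 ⟨hy.1, hy.2, x, hx.mono (by lia) subset_rfl, hxy⟩, p, ?_,
          fun z hz => hA z (by simp [hz])⟩
        simp
      · have hyT : y ∈ (T : Set V)ᶜ ∪ {v} := by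
          by_cases hyv : y = v
          · exact .inr hyv
          · exact .inl fun hyT => hy ⟨hyT, hyv⟩
        obtain ⟨z, hz, hzu⟩ := ih (j + 1) (fun z hz => hA z (by simp [hz])) (by lia)
          (hx.trans (.of_adj hxy hx.right_mem hyT)) hu huv
        exact ⟨z, hz, hzu.mono (by simp) subset_rfl⟩
  obtain ⟨p, hp, hA⟩ := h
  obtain ⟨z, hz, hzu⟩ := key v u p 0 hA (by lia) (.refl (.inr rfl)) hu huv
  exact ⟨z, hz, hzu.mono (by lia) subset_rfl⟩

/-- `Q` is a small set of vertices outside of `S` that connects `u` to `v`. -/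
def IsConnector (G : SimpleGraph V) (S : Finset V) (r : ℕ) (u v : V) (Q : Finset V) : Prop :=
  Disjoint S Q ∧ Q.card ≤ r + 1 ∧ (∀ x ∈ Q, ReachIn G (insert u (Q : Set V)) r u x) ∧
    ∃ w ∈ insert u (Q : Set V), G.Adj w v

theorem ReachIn.exists_adj_right {G : SimpleGraph V} {A : Set V} {r : ℕ} {u v : V}
    (h : ReachIn G A r u v) (huv : u ≠ v) :
    ∃ w, ReachIn G (A \ {v}) r u w ∧ G.Adj w v := by
  obtain ⟨p, hp, hA⟩ := h
  have key : ∀ (u v : V) (p : G.Walk u v), u ≠ v → (∀ z ∈ p.support, z ∈ A) →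
      ∃ w, ReachIn G (A \ {v}) p.length u w ∧ G.Adj w v := by
    intro u v p
    induction p with
    | nil => exact fun h => (h rfl).elim
    | @cons u y v huy p ih =>
      intro huv hA
      have hu : u ∈ A \ {v} := ⟨hA u (by simp), huv⟩
      by_cases hyv : y = v
      · exact ⟨u, .refl hu, hyv ▸ huy⟩
      · obtain ⟨w, hw, hwv⟩ := ih hyv fun z hz => hA z (by simp [hz])
        refine ⟨w, ((ReachIn.of_adj huy hu hw.left_mem).trans hw).mono ?_ subset_rfl, hwv⟩
        rw [Walk.length_cons, add_comm]
  obtain ⟨w, hw, hwv⟩ := key u v p huv hA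
  exact ⟨w, hw.mono hp subset_rfl, hwv⟩

open scoped Classical in
theorem ReachIn.exists_isConnector {G : SimpleGraph V} {S T : Finset V} {r : ℕ} {u v : V}
    (hST : S ⊆ T) (h : ReachIn G ((T : Set V)ᶜ ∪ {u, v}) r u v) (huv : u ≠ v) :
    ∃ Q, IsConnector G S r u v Q ∧ Disjoint T Q := by
  obtain ⟨w, ⟨p, hp, hA⟩, hwv⟩ := h.exists_adj_right huv
  have hTQ : Disjoint T (p.support.toFinset.erase u) := by
    refine Finset.disjoint_right.2 fun x hx hxT => ?_
    obtain ⟨hxu, hx⟩ := Finset.mem_erase.1 hx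
    obtain ⟨hx1 | hx1 | hx1, hx2⟩ := hA x (List.mem_toFinset.1 hx)
    exacts [hx1 hxT, hxu hx1, hx2 hx1]
  have hmem : ∀ x ∈ p.support, x ∈ insert u ((p.support.toFinset.erase u : Finset V) : Set V) := by
    intro x hx
    by_cases hxu : x = u
    · exact .inl hxu
    · exact .inr (by simp [hxu, hx])
  refine ⟨p.support.toFinset.erase u, ⟨hTQ.mono_left hST, ?_, fun x hx => ?_, w,
    hmem w p.end_mem_support, hwv⟩, hTQ⟩
  · refine (Finset.card_le_card (Finset.erase_subset _ _)).trans
      ((List.toFinset_card_le _).trans ?_)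
    rw [Walk.length_support]
    lia
  · have hx' : x ∈ p.support := List.mem_toFinset.1 (Finset.mem_of_mem_erase hx)
    exact ⟨p.takeUntil x hx', (p.length_takeUntil_le_length hx').trans hp,
      fun z hz => hmem z (p.support_takeUntil_subset_support hx' hz)⟩

open scoped Classical in
theorem exists_maximal_connectors (G : SimpleGraph V) (S : Finset V) (r : ℕ)
    (P : Finset (V × V)) :
    ∃ E ⊆ P, ∃ Q : V × V → Finset V, (∀ e ∈ E, IsConnector G S r e.1 e.2 (Q e)) ∧
      (∀ e ∈ E, ∀ e' ∈ E, e ≠ e' → Disjoint (Q e) (Q e')) ∧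
      ∀ e ∈ P, e ∉ E → ∀ Q', IsConnector G S r e.1 e.2 Q' → ¬ Disjoint (E.biUnion Q) Q' := by
  induction P using Finset.induction_on with
  | empty => exact ⟨∅, by simp, fun _ => ∅, by simp, by simp, by simp⟩
  | @insert e P he ih =>
    obtain ⟨E, hE, Q, hQ, hdisj, hmax⟩ := ih
    have heE : e ∉ E := fun h => he (hE h)
    by_cases hnew : ∃ Q', IsConnector G S r e.1 e.2 Q' ∧ Disjoint (E.biUnion Q) Q'
    · obtain ⟨Q', hQ', hdis⟩ := hnew
      have hne : ∀ e' ∈ E, e' ≠ e := fun e' he' h => heE (h ▸ he')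
      have hdis' : ∀ e' ∈ E, Disjoint (Q e') Q' := fun e' he' =>
        hdis.mono_left (Finset.subset_biUnion_of_mem Q he')
      refine ⟨insert e E, Finset.insert_subset_insert _ hE, Function.update Q e Q', ?_, ?_, ?_⟩
      · intro e' he'
        rcases Finset.mem_insert.1 he' with rfl | he'
        · simpa using hQ'
        · simpa [hne e' he'] using hQ e' he'
      · intro e₁ h₁ e₂ h₂ h₁₂
        rcases Finset.mem_insert.1 h₁ with rfl | h₁' <;>
          rcases Finset.mem_insert.1 h₂ with rfl | h₂'
        · exact (h₁₂ rfl).elim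
        · simpa [hne e₂ h₂'] using (hdis' e₂ h₂').symm
        · simpa [hne e₁ h₁'] using hdis' e₁ h₁'
        · simpa [hne e₁ h₁', hne e₂ h₂'] using hdisj e₁ h₁' e₂ h₂' h₁₂
      · intro e' he' he'E Q'' hQ'' hd
        rw [Finset.mem_insert, not_or] at he'E
        refine hmax e' ((Finset.mem_insert.1 he').resolve_left he'E.1) he'E.2 Q'' hQ''
          (hd.mono_left fun x hx => ?_)
        obtain ⟨e₁, h₁, hx⟩ := Finset.mem_biUnion.1 hx
        exact Finset.mem_biUnion.2 ⟨e₁, Finset.mem_insert_of_mem h₁, by simpa [hne e₁ h₁] using hx⟩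
    · push Not at hnew
      refine ⟨E, hE.trans (Finset.subset_insert _ _), Q, hQ, hdisj, fun e' he' he'E => ?_⟩
      rcases Finset.mem_insert.1 he' with rfl | he'
      exacts [hnew, hmax e' he' he'E]

/-- Contracting each connector into its first endpoint realizes the graph of connected pairs as a
shallow minor. -/
theorem isDepthMinor_of_connectors {G : SimpleGraph V} {S : Finset V} {r : ℕ}
    {E : Finset (V × V)} {Q : V × V → Finset V}
    (hQ : ∀ e ∈ E, IsConnector G S r e.1 e.2 (Q e))
    (hdisj : ∀ e ∈ E, ∀ e' ∈ E, e ≠ e' → Disjoint (Q e) (Q e')) :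
    IsDepthMinor r ((SimpleGraph.fromRel fun a b => (a, b) ∈ E).induce (S : Set V)) G := by
  refine ⟨fun u => {x | x = u ∨ ∃ e ∈ E, e.1 = u ∧ x ∈ Q e}, fun u => ?_, fun u v huv => ?_,
    fun u v huv => ?_⟩
  · rw [hasRadiusLE_induce_iff]
    refine ⟨u, .inl rfl, ?_⟩
    rintro x (rfl | ⟨e, he, heu, hx⟩)
    · exact .refl (.inl rfl)
    · rw [← heu]
      refine ((hQ e he).2.2.1 x hx).mono le_rfl (Set.insert_subset (.inl heu) fun y hy => ?_)
      exact .inr ⟨e, he, heu, hy⟩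
  · refine Set.disjoint_left.2 ?_
    rintro x (hx | ⟨e, he, heu, hx⟩) (hx' | ⟨e', he', heu', hx'⟩)
    · exact huv (Subtype.ext (hx.symm.trans hx'))
    · exact Finset.disjoint_left.1 (hQ e' he').1 (hx ▸ u.2) hx'
    · exact Finset.disjoint_left.1 (hQ e he).1 (hx' ▸ v.2) hx
    · by_cases hee : e = e'
      · exact huv (Subtype.ext (by rw [← heu, ← heu', hee]))
      · exact Finset.disjoint_left.1 (hdisj e he e' he' hee) hx hx'
  · have key : ∀ a b : V, (a, b) ∈ E →
        ∃ w, (w = a ∨ ∃ e ∈ E, e.1 = a ∧ w ∈ Q e) ∧ G.Adj w b := by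
      intro a b hab
      obtain ⟨w, hw, hwb⟩ := (hQ _ hab).2.2.2
      refine ⟨w, ?_, hwb⟩
      rcases hw with hw | hw
      exacts [.inl hw, .inr ⟨_, hab, rfl, hw⟩]
    have huv' : (SimpleGraph.fromRel fun a b => (a, b) ∈ E).Adj (u : V) v := huv
    rcases ((SimpleGraph.fromRel_adj _ _ _).1 huv').2 with h | h
    · obtain ⟨w, hw, hwb⟩ := key _ _ h
      exact ⟨w, hw, v, .inl rfl, hwb⟩
    · obtain ⟨w, hw, hwb⟩ := key _ _ h
      exact ⟨u, .inl rfl, w, hw, hwb.symm⟩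

/-- The balls around the vertices of `R` outside of `T` and the remaining vertices of `T` form the
branch sets of a shallow minor. -/
theorem isDepthMinor_of_reachBoundary {G : SimpleGraph V} {R T : Finset V} {r : ℕ}
    (hdisj : ∀ u ∈ R, ∀ v ∈ R, u ≠ v → ∀ x, ReachIn G ((T : Set V)ᶜ ∪ {u}) r u x →
      ¬ ReachIn G ((T : Set V)ᶜ ∪ {v}) r v x) :
    IsDepthMinor r ((SimpleGraph.fromRel fun a b => a ∈ R ∧ b ∈ reachBoundary G T r a).induce
      (T : Set V)) G := by
  refine ⟨fun u => {x | x = u ∨ (u : V) ∈ R ∧ ReachIn G ((T : Set V)ᶜ ∪ {(u : V)}) r u x},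
    fun u => ?_, fun u v huv => ?_, fun u v huv => ?_⟩
  · rw [hasRadiusLE_induce_iff]
    refine ⟨u, .inl rfl, ?_⟩
    rintro x (rfl | ⟨hu, p, hp, hA⟩)
    · exact .refl (.inl rfl)
    · classical
      refine ⟨p, hp, fun z hz => .inr ⟨hu, p.takeUntil z hz,
        (p.length_takeUntil_le_length hz).trans hp,
        fun y hy => hA y (p.support_takeUntil_subset_support hz hy)⟩⟩
  · have huv' : (u : V) ≠ v := fun h => huv (Subtype.ext h)
    refine Set.disjoint_left.2 ?_
    rintro x (hx | ⟨hu, hx⟩) (hx' | ⟨hv, hx'⟩)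
    · exact huv' (hx.symm.trans hx')
    · rcases hx'.right_mem with h | h
      exacts [h (hx ▸ u.2), huv' (hx.symm.trans h)]
    · rcases hx.right_mem with h | h
      exacts [h (hx' ▸ v.2), huv' (h.symm.trans hx')]
    · exact hdisj u hu v hv huv' x hx hx'
  · have huv' : (SimpleGraph.fromRel fun a b => a ∈ R ∧ b ∈ reachBoundary G T r a).Adj (u : V) v :=
      huv
    rcases ((SimpleGraph.fromRel_adj _ _ _).1 huv').2 with ⟨hu, h⟩ | ⟨hv, h⟩
    · obtain ⟨-, -, x, hx, hxv⟩ := mem_reachBoundary.1 h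
      exact ⟨x, .inr ⟨hu, hx⟩, v, .inl rfl, hxv⟩
    · obtain ⟨-, -, x, hx, hxv⟩ := mem_reachBoundary.1 h
      exact ⟨u, .inl rfl, x, .inr ⟨hv, hx⟩, hxv.symm⟩

open scoped Classical in
/-- If all shallow minors of `G` are `D`-degenerate, then every nonempty set `S` contains a vertex
with a small boundary. -/
theorem exists_card_reachBoundary_le {G : SimpleGraph V} {D r : ℕ}
    (hG : ∀ (H : SimpleGraph V) (U : Finset V),
      IsDepthMinor (2 * r) (H.induce (U : Set V)) G → DegenerateOn H U D)
    {S : Finset V} (hS : S.Nonempty) :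
    ∃ v ∈ S, ∃ T, S ⊆ T ∧
      (reachBoundary G T r v).card ≤ 2 * D * (1 + 2 * (2 * r + 1) * D) * (D + 1) := by
  obtain ⟨E, hE, Q, hQ, hdisj, hmax⟩ := exists_maximal_connectors G S (2 * r) S.offDiag
  have hdeg := hG _ _ (isDepthMinor_of_connectors hQ hdisj)
  set H := SimpleGraph.fromRel fun a b => (a, b) ∈ E
  set M := E.biUnion Q
  have hEcard : E.card ≤ 2 * D * S.card := by
    refine hdeg.card_le_of_forall_adj fun e he => ?_
    obtain ⟨h1, h2, h3⟩ := Finset.mem_offDiag.1 (hE he)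
    exact ⟨h1, h2, (SimpleGraph.fromRel_adj _ _ _).2 ⟨h3, .inl he⟩⟩
  have hMcard : M.card ≤ E.card * (2 * r + 1) :=
    Finset.card_biUnion_le_card_mul _ _ _ fun e he => (hQ e he).2.1
  obtain ⟨R, hRS, hind, hR⟩ := hdeg.exists_independent
  set T := S ∪ M
  have hST : S ⊆ T := Finset.subset_union_left
  have hRdisj : ∀ u ∈ R, ∀ v ∈ R, u ≠ v → ∀ x, ReachIn G ((T : Set V)ᶜ ∪ {u}) r u x →
      ¬ ReachIn G ((T : Set V)ᶜ ∪ {v}) r v x := by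
    intro u hu v hv huv x hux hvx
    have h1 : ReachIn G ((T : Set V)ᶜ ∪ {u, v}) (2 * r) u v := by
      refine ((hux.mono le_rfl ?_).trans ((hvx.mono le_rfl ?_).symm)).mono (by lia) subset_rfl
      · exact Set.union_subset_union_right _ (by simp)
      · exact Set.union_subset_union_right _ (by simp)
    obtain ⟨Q', hQ', hTQ⟩ := h1.exists_isConnector hST huv
    refine hmax (u, v) (Finset.mem_offDiag.2 ⟨hRS hu, hRS hv, huv⟩) (fun he => ?_) Q' hQ'
      (hTQ.mono_left Finset.subset_union_right)
    exact hind u hu v hv ((SimpleGraph.fromRel_adj _ _ _).2 ⟨huv, .inl he⟩)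
  have hdeg' := hG _ _ ((isDepthMinor_of_reachBoundary hRdisj).mono_depth
    (by lia))
  set q := 2 * D * (1 + 2 * (2 * r + 1) * D) * (D + 1) with hq
  by_contra! hcon
  have h1 : R.card * (q + 1) ≤ (R.sigma fun v => reachBoundary G T r v).card := by
    rw [Finset.card_sigma]
    exact Finset.card_nsmul_le_sum _ _ _ fun v hv => Nat.succ_le_of_lt (hcon v (hRS hv) T hST)
  have h2 : (R.sigma fun v => reachBoundary G T r v).card ≤ 2 * D * T.card := by
    rw [← Finset.card_image_of_injective _ (Equiv.sigmaEquivProd V V).injective]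
    refine hdeg'.card_le_of_forall_adj fun e he => ?_
    obtain ⟨⟨a, b⟩, hab, rfl⟩ := Finset.mem_image.1 he
    obtain ⟨ha, hb⟩ := Finset.mem_sigma.1 hab
    obtain ⟨h3, h4, -⟩ := mem_reachBoundary.1 hb
    exact ⟨hST (hRS ha), h3, (SimpleGraph.fromRel_adj _ _ _).2 ⟨h4.symm, .inl ⟨ha, hb⟩⟩⟩
  have h3 : T.card ≤ (1 + 2 * (2 * r + 1) * D) * S.card := by
    refine (Finset.card_union_le _ _).trans ?_
    have := hMcard.trans (Nat.mul_le_mul_right _ hEcard)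
    linarith
  have h4 : R.card * (q + 1) ≤ R.card * q := calc
    R.card * (q + 1) ≤ 2 * D * T.card := h1.trans h2
    _ ≤ 2 * D * ((1 + 2 * (2 * r + 1) * D) * ((D + 1) * R.card)) :=
      Nat.mul_le_mul_left _ (h3.trans (Nat.mul_le_mul_left _ hR))
    _ = R.card * q := by rw [hq]; ring
  have h5 : 0 < R.card := by
    rcases Nat.eq_zero_or_pos R.card with h | h
    · have := hS.card_pos
      rw [h, mul_zero] at hR
      lia
    · exact h
  have := Nat.le_of_mul_le_mul_left h4 h5
  lia

open scoped Classical in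
/-- If every nonempty set has a vertex suitable to be its last element, then there is an ordering
in which every vertex is suitable to be the last element of its initial segment. -/
theorem exists_elimination_order {P : V → Finset V → Prop}
    (hP : ∀ S : Finset V, S.Nonempty → ∃ v ∈ S, P v S) (S : Finset V) :
    ∃ f : V → ℕ, Set.InjOn f S ∧ (∀ v ∈ S, f v < S.card) ∧
      ∀ v ∈ S, P v (S.filter fun x => f x ≤ f v) := by
  induction hn : S.card generalizing S with
  | zero => exact ⟨fun _ => 0, by simp [Finset.card_eq_zero.1 hn]⟩
  | succ n ih =>
    obtain ⟨v, hv, hPv⟩ := hP S (Finset.card_pos.1 (by lia))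
    obtain ⟨f, hinj, hlt, hPf⟩ := ih (S.erase v)
      (by rw [Finset.card_erase_of_mem hv, hn, Nat.add_sub_cancel])
    have hf : ∀ x ∈ S, x ≠ v → f x < n := fun x hx hxv => hlt x (Finset.mem_erase.2 ⟨hxv, hx⟩)
    refine ⟨Function.update f v n, fun x hx y hy hxy => ?_, fun x hx => ?_, fun x hx => ?_⟩
    · by_cases hxv : x = v <;> by_cases hyv : y = v
      · rw [hxv, hyv]
      · subst hxv
        have := hf y hy hyv
        simp [hyv] at hxy
        lia
      · subst hyv
        have := hf x hx hxv
        simp [hxv] at hxy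
        lia
      · simp only [Function.update_of_ne hxv, Function.update_of_ne hyv] at hxy
        exact hinj (by simpa [hxv] using hx) (by simpa [hyv] using hy) hxy
    · by_cases hxv : x = v
      · simp [hxv]
      · have := hf x hx hxv
        simp [hxv]
        lia
    · by_cases hxv : x = v
      · subst hxv
        convert hPv using 1
        refine Finset.filter_true_of_mem fun y hy => ?_
        by_cases hyx : y = x
        · rw [hyx]
        · simpa [hyx] using (hf y hy hyx).le
      · convert hPf x (Finset.mem_erase.2 ⟨hxv, hx⟩) using 1
        ext y
        simp only [Finset.mem_filter, Finset.mem_erase, Function.update_of_ne hxv]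
        by_cases hyv : y = v
        · have := hf x hx hxv
          simp [hyv]
          lia
        · simp [hyv]

open scoped Classical in
/-- The vertices reachable from `v` by applying the set-valued map `Z` at most `j` times. -/
noncomputable def iterReach (Z : V → Finset V) : ℕ → V → Finset V
  | 0, v => {v}
  | j + 1, v => insert v ((Z v).biUnion (iterReach Z j))

theorem card_iterReach_le {Z : V → Finset V} {q : ℕ} (hZ : ∀ v, (Z v).card ≤ q) (j : ℕ) (v : V) :
    (iterReach Z j v).card ≤ (q + 1) ^ j := by
  classical
  induction j generalizing v with
  | zero => simp [iterReach]
  | succ j ih =>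
    refine (Finset.card_insert_le _ _).trans ?_
    have h1 := (Finset.card_biUnion_le_card_mul (Z v) (iterReach Z j) _ fun z _ => ih z).trans
      (Nat.mul_le_mul_right _ (hZ v))
    have h2 := Nat.one_le_pow j (q + 1) (by lia)
    rw [pow_succ, mul_add, mul_comm _ q]
    lia

theorem ReachIn.mem_iterReach {G : SimpleGraph V} {T : V → Finset V} {A : Set V} {r j : ℕ}
    {u v : V} (hT : ∀ x ∈ A, u ∈ T x) (hj : j ≤ r) (h : ReachIn G A j v u) :
    u ∈ iterReach (fun x => reachBoundary G (T x) r x) j v := by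
  classical
  induction j generalizing v with
  | zero =>
    obtain ⟨p, hp, -⟩ := h
    simp [iterReach, p.eq_of_length_eq_zero (by lia)]
  | succ j ih =>
    by_cases huv : u = v
    · subst huv
      exact Finset.mem_insert_self _ _
    · obtain ⟨z, hz, hzu⟩ := h.exists_mem_reachBoundary hj (hT v h.left_mem) huv
      exact Finset.mem_insert_of_mem (Finset.mem_biUnion.2 ⟨z, hz, ih (by lia) hzu⟩)

theorem WReach.reachIn {G : SimpleGraph V} {le : V → V → Prop} [IsLinearOrder V le] {r : ℕ}
    {u v : V} (h : u ∈ WReach G le r v) : ReachIn G {x | le u x} r v u := by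
  obtain ⟨huv, p, -, hp, hlt⟩ := h
  refine ReachIn.symm ⟨p, hp, fun x hx => ?_⟩
  by_cases hxu : x = u
  · exact hxu ▸ refl_of le u
  by_cases hxv : x = v
  · exact hxv ▸ huv
  · exact (hlt x hx hxu hxv).1

theorem wcol_le_of_reachBoundary [Fintype V] {G : SimpleGraph V} {r q : ℕ}
    (h : ∀ S : Finset V, S.Nonempty → ∃ v ∈ S, ∃ T, S ⊆ T ∧ (reachBoundary G T r v).card ≤ q) :
    wcol G r ≤ (q + 1) ^ r := by
  classical
  obtain ⟨f, hinj, -, hf⟩ := exists_elimination_order h Finset.univ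
  choose T hST hT using fun v => hf v (Finset.mem_univ v)
  have hf' : Function.Injective f := fun x y hxy => hinj (by simp) (by simp) hxy
  let le : V → V → Prop := fun x y => f x ≤ f y
  have hle : IsLinearOrder V le := Function.Injective.isLinearOrder_onFun (· ≤ ·) hf'
  refine Nat.sInf_le ⟨le, hle, fun v => ?_⟩
  refine le_trans ?_ (card_iterReach_le hT r v)
  rw [← Set.ncard_coe_finset]
  refine Set.ncard_le_ncard (fun u hu => ?_) (Finset.finite_toSet _)
  exact (WReach.reachIn hu).mem_iterReach (fun x hx => hST x (by simpa using hx)) le_rfl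

theorem wcol_le_of_degenerateOn [Fintype V] {G : SimpleGraph V} {D r : ℕ}
    (hG : ∀ (H : SimpleGraph V) (U : Finset V),
      IsDepthMinor (2 * r) (H.induce (U : Set V)) G → DegenerateOn H U D) :
    wcol G r ≤ (2 * D * (1 + 2 * (2 * r + 1) * D) * (D + 1) + 1) ^ r :=
  wcol_le_of_reachBoundary fun _ hS => exists_card_reachBoundary_le hG hS

theorem IsSubgraphOf.isDepthMinor {H G : FGraph} (h : IsSubgraphOf H G) {r : ℕ}
    {K : SimpleGraph W} (hK : IsDepthMinor r K H.G) : IsDepthMinor r K G.G := by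
  obtain ⟨f, hf, hadj⟩ := h
  obtain ⟨φ, hr, hd, he⟩ := hK
  refine ⟨fun w => f '' φ w, fun w => ?_, fun a b hab => ?_, fun a b hab => ?_⟩
  · obtain ⟨c, hc, hcr⟩ := hasRadiusLE_induce_iff.1 (hr w)
    refine hasRadiusLE_induce_iff.2 ⟨f c, Set.mem_image_of_mem f hc, ?_⟩
    rintro _ ⟨x, hx, rfl⟩
    obtain ⟨p, hp, hA⟩ := hcr x hx
    refine ⟨p.map ⟨f, fun h => hadj _ _ h⟩, (Walk.length_map _ _).trans_le hp, fun z hz => ?_⟩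
    rw [Walk.support_map] at hz
    obtain ⟨y, hy, rfl⟩ := List.mem_map.1 hz
    exact ⟨y, hA y hy, rfl⟩
  · exact (Set.disjoint_image_iff hf).2 (hd hab)
  · obtain ⟨u, hu, v, hv, huv⟩ := he a b hab
    exact ⟨f u, ⟨u, hu, rfl⟩, f v, ⟨v, hv, rfl⟩, hadj u v huv⟩

theorem IsDepthMinor.exists_injective {r : ℕ} {H : SimpleGraph W} {G : SimpleGraph V}
    (h : IsDepthMinor r H G) : ∃ f : W → V, Function.Injective f := by
  obtain ⟨φ, hr, hd, -⟩ := h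
  choose c hc using fun w => hasRadiusLE_induce_iff.1 (hr w)
  refine ⟨c, fun a b hab => by_contra fun hne => ?_⟩
  exact Set.disjoint_left.1 (hd hne) (hc a).1 (hab ▸ (hc b).1)

open scoped Classical in
theorem NowhereDense.exists_degenerateOn {C : Set FGraph} (hC : NowhereDense C) (r k : ℕ) :
    ∃ c, 1 ≤ c ∧ ∀ G ∈ C, ∀ H : FGraph, IsSubgraphOf H G → ∀ D : ℕ,
      c * Fintype.card H.V ≤ (D + 1) ^ k → ∀ (K : SimpleGraph H.V) (U : Finset H.V),
      IsDepthMinor r (K.induce (U : Set H.V)) H.G → DegenerateOn K U D := by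
  obtain ⟨s, hs⟩ := exists_isDepthMinor_top_of_le_degree k
  obtain ⟨m, hm⟩ := hC ((2 * r + 1) * s + r)
  obtain ⟨c, hc, h⟩ := hs (m + 1) (by lia)
  refine ⟨c, hc, fun G hG H hHG D hD K U hKU U' hU' hne => ?_⟩
  by_contra! hdeg
  have hKU' : IsDepthMinor r (K.induce (U' : Set H.V)) H.G :=
    hKU.comp_hom (fun x => ⟨x, hU' x.2⟩) (fun x y hxy => Subtype.ext (Subtype.mk.inj hxy))
      fun _ _ hab => hab
  have h1 := h _ K U' (D + 1) hne (fun u hu => hdeg u hu)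
    ((Nat.mul_le_mul_left _ (Finset.card_le_univ U')).trans hD)
  exact hm G hG (hHG.isDepthMinor ((h1.trans hKU').comp_hom Fin.castSucc
    (Fin.castSucc_injective m) fun a b hab => by simpa using hab))

theorem wcol_eq_zero [IsEmpty V] (G : SimpleGraph V) (r : ℕ) : wcol G r = 0 :=
  Nat.le_zero.1 (Nat.sInf_le ⟨fun _ _ => True,
    { refl := isEmptyElim, trans := isEmptyElim, antisymm := isEmptyElim, total := isEmptyElim },
    isEmptyElim⟩)

theorem NowhereDense.exists_wcol_le {C : Set FGraph} (hC : NowhereDense C) (r : ℕ) {ε : ℝ}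
    (hε : 0 < ε) : ∃ w : ℝ, ∀ G ∈ C, ∀ H : FGraph, IsSubgraphOf H G →
      (wcol H.G r : ℝ) ≤ w * (Fintype.card H.V : ℝ) ^ ε := by
  obtain ⟨k, hk⟩ := exists_nat_gt (3 * r / ε)
  have hk0 : (0 : ℝ) < k := lt_of_le_of_lt (by positivity) hk
  obtain ⟨c, hc, h⟩ := hC.exists_degenerateOn (2 * r) k
  refine ⟨(13 * (2 * r + 1) * 8) ^ r * (c : ℝ) ^ ε, fun G hG H hHG => ?_⟩
  rcases Nat.eq_zero_or_pos (Fintype.card H.V) with hn | hn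
  · have := Fintype.card_eq_zero_iff.1 hn
    rw [wcol_eq_zero, hn, Nat.cast_zero, Real.zero_rpow hε.ne', mul_zero]
  set n := Fintype.card H.V
  set a : ℝ := (c * n : ℝ) ^ (1 / k : ℝ)
  have hcn : (1 : ℝ) ≤ c * n := by exact_mod_cast Nat.one_le_iff_ne_zero.2 (by positivity)
  have ha : 1 ≤ a := Real.one_le_rpow hcn (by positivity)
  have hak : a ^ k = c * n := by
    rw [← Real.rpow_natCast, ← Real.rpow_mul (by positivity), one_div_mul_cancel hk0.ne',
      Real.rpow_one]
  obtain ⟨D, hD⟩ : ∃ D, D = ⌈a⌉₊ := ⟨_, rfl⟩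
  have hD1 : a ≤ D := hD ▸ Nat.le_ceil a
  have hD2 : (D : ℝ) ≤ 2 * a := by
    have := Nat.ceil_lt_add_one (zero_le_one.trans ha)
    rw [← hD] at this
    linarith
  have hDk : c * n ≤ (D + 1) ^ k := by
    have : (c * n : ℝ) ≤ (D + 1) ^ k := by
      rw [← hak]
      gcongr
      linarith
    exact_mod_cast this
  have hwcol := wcol_le_of_degenerateOn (h G hG H hHG D hDk)
  have hD1' : (1 : ℝ) ≤ D := ha.trans hD1
  have hq : 2 * (D : ℝ) * (1 + 2 * (2 * r + 1) * D) * (D + 1) + 1 ≤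
      13 * (2 * r + 1) * D ^ 3 := by
    have h1 : 1 + 2 * (2 * (r : ℝ) + 1) * D ≤ 3 * (2 * r + 1) * D := by
      nlinarith [mul_nonneg (Nat.cast_nonneg (α := ℝ) r) (zero_le_one.trans hD1')]
    calc 2 * (D : ℝ) * (1 + 2 * (2 * r + 1) * D) * (D + 1) + 1
        ≤ 2 * D * (3 * (2 * r + 1) * D) * (D + D) + (2 * r + 1) * D ^ 3 := by
          gcongr
          exact one_le_mul_of_one_le_of_one_le (by linarith [Nat.cast_nonneg (α := ℝ) r])
            (one_le_pow₀ hD1')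
      _ = 13 * (2 * r + 1) * D ^ 3 := by ring
  calc (wcol H.G r : ℝ)
      ≤ (2 * (D : ℝ) * (1 + 2 * (2 * r + 1) * D) * (D + 1) + 1) ^ r := by exact_mod_cast hwcol
    _ ≤ (13 * (2 * r + 1) * (2 * a) ^ 3) ^ r := by
      gcongr
      exact hq.trans (by gcongr)
    _ = (13 * (2 * r + 1) * 8) ^ r * a ^ (3 * r) := by rw [pow_mul, ← mul_pow]; ring
    _ ≤ (13 * (2 * r + 1) * 8) ^ r * (c * n : ℝ) ^ ε := by
      gcongr
      rw [← Real.rpow_natCast, ← Real.rpow_mul (by positivity)]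
      refine Real.rpow_le_rpow_of_exponent_le hcn ?_
      rw [div_lt_iff₀ hε] at hk
      rw [div_mul_eq_mul_div, div_le_iff₀ hk0]
      push_cast
      linarith
    _ = (13 * (2 * r + 1) * 8) ^ r * (c : ℝ) ^ ε * (n : ℝ) ^ ε := by
      rw [Real.mul_rpow (by positivity) (by positivity), ← mul_assoc]

theorem ReachIn.induce {G : SimpleGraph V} {A U : Set V} {j : ℕ} {x y : V}
    (h : ReachIn G A j x y) (hAU : A ⊆ U) :
    ReachIn (G.induce U) (Subtype.val ⁻¹' A) j ⟨x, hAU h.left_mem⟩ ⟨y, hAU h.right_mem⟩ := by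
  obtain ⟨p, hp, hA⟩ := h
  have hpU : ∀ z ∈ p.support, z ∈ U := fun z hz => hAU (hA z hz)
  have hlen := congrArg Walk.length (p.map_induce hpU)
  have hsupp := congrArg Walk.support (p.map_induce hpU)
  rw [Walk.length_map] at hlen
  erw [Walk.support_map] at hsupp
  refine ⟨p.induce U hpU, hlen.trans_le hp, fun z hz => hA z ?_⟩
  exact hsupp ▸ List.mem_map_of_mem (f := (Embedding.induce U).toHom) hz

open scoped Classical in
theorem ReachIn.exists_finset {G : SimpleGraph V} {A : Set V} {j : ℕ} {x y : V}
    (h : ReachIn G A j x y) : ∃ Q : Finset V, (Q : Set V) ⊆ A ∧ Q.card ≤ j + 1 ∧ x ∈ Q ∧ y ∈ Q ∧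
      ∀ z ∈ Q, ReachIn G Q j x z := by
  obtain ⟨p, hp, hA⟩ := h
  refine ⟨p.support.toFinset, fun z hz => hA z (by simpa using hz), ?_, by simp, by simp,
    fun z hz => ?_⟩
  · refine (List.toFinset_card_le _).trans ?_
    rw [Walk.length_support]
    lia
  · have hz' := List.mem_toFinset.1 hz
    exact ⟨p.takeUntil z hz', (p.length_takeUntil_le_length hz').trans hp,
      fun w hw => by simpa using p.support_takeUntil_subset_support hz' hw⟩

open scoped Classical in
/-- A clique that is a shallow minor is already a minor of a small induced subgraph. -/
theorem IsDepthMinor.exists_small_induce {G : SimpleGraph V} {r m : ℕ}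
    (h : IsDepthMinor r (⊤ : SimpleGraph (Fin m)) G) :
    ∃ U : Finset V, U.card ≤ m * (m * (2 * (r + 1))) ∧
      IsDepthMinor r (⊤ : SimpleGraph (Fin m)) (G.induce (U : Set V)) := by
  obtain ⟨φ, hr, hd, he⟩ := h
  simp only [hasRadiusLE_induce_iff] at hr
  choose c hc hcr using hr
  have he' : ∀ a b, ∃ u ∈ φ a, ∃ v ∈ φ b, a ≠ b → G.Adj u v := by
    intro a b
    by_cases hab : a = b
    · exact ⟨c a, hc a, c b, hc b, fun h => (h hab).elim⟩
    · obtain ⟨u, hu, v, hv, huv⟩ := he a b ((top_adj a b).2 hab)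
      exact ⟨u, hu, v, hv, fun _ => huv⟩
  choose u hu v hv huv using he'
  choose P hPφ hPcard hcP huP hPr using fun a b => (hcr a (u a b) (hu a b)).exists_finset
  choose Q hQφ hQcard hcQ hvQ hQr using fun a b => (hcr b (v a b) (hv a b)).exists_finset
  let ψ : Fin m → Finset V := fun a => Finset.univ.biUnion fun b => P a b ∪ Q b a
  have hPψ : ∀ a b, P a b ⊆ ψ a := fun a b =>
    Finset.subset_union_left.trans (Finset.subset_biUnion_of_mem (fun b => P a b ∪ Q b a)
      (Finset.mem_univ b))
  have hQψ : ∀ a b, Q b a ⊆ ψ a := fun a b =>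
    Finset.subset_union_right.trans (Finset.subset_biUnion_of_mem (fun b => P a b ∪ Q b a)
      (Finset.mem_univ b))
  have hψφ : ∀ a, (ψ a : Set V) ⊆ φ a := by
    intro a x hx
    obtain ⟨b, -, hx⟩ := Finset.mem_biUnion.1 hx
    rcases Finset.mem_union.1 hx with hx | hx
    exacts [hPφ a b hx, hQφ b a hx]
  have hψr : ∀ a, ∀ x ∈ ψ a, ReachIn G (ψ a) r (c a) x := by
    intro a x hx
    obtain ⟨b, -, hx⟩ := Finset.mem_biUnion.1 hx
    rcases Finset.mem_union.1 hx with hx | hx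
    exacts [(hPr a b x hx).mono le_rfl (hPψ a b), (hQr b a x hx).mono le_rfl (hQψ a b)]
  have hψU : ∀ a, ψ a ⊆ Finset.univ.biUnion ψ := fun a =>
    Finset.subset_biUnion_of_mem ψ (Finset.mem_univ a)
  refine ⟨Finset.univ.biUnion ψ, ?_, fun a => Subtype.val ⁻¹' (ψ a : Set V), fun a => ?_,
    fun a b hab => ?_, fun a b hab => ?_⟩
  · refine (Finset.card_biUnion_le_card_mul _ _ (m * (2 * (r + 1))) fun a _ => ?_).trans (by simp)
    refine (Finset.card_biUnion_le_card_mul _ _ (2 * (r + 1)) fun b _ => ?_).trans (by simp)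
    refine (Finset.card_union_le _ _).trans ?_
    have := hPcard a b
    have := hQcard b a
    lia
  · refine hasRadiusLE_induce_iff.2 ⟨⟨c a, hψU a (hPψ a a (hcP a a))⟩, hPψ a a (hcP a a), ?_⟩
    exact fun x hx => (hψr a x hx).induce (hψU a)
  · exact ((hd hab).mono (hψφ a) (hψφ b)).preimage _
  · exact ⟨⟨u a b, hψU a (hPψ a b (huP a b))⟩, hPψ a b (huP a b),
      ⟨v a b, hψU b (hQψ b a (hvQ a b))⟩, hQψ b a (hvQ a b), huv a b hab⟩

theorem Finset.exists_le_of_isLinearOrder {α : Type} (le : α → α → Prop) [IsLinearOrder α le]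
    {s : Finset α} (hs : s.Nonempty) : ∃ u ∈ s, ∀ x ∈ s, le u x := by
  induction hs using Finset.Nonempty.cons_induction with
  | singleton a => exact ⟨a, by simp, by simpa using refl_of le a⟩
  | cons a s ha hs ih =>
    obtain ⟨u, hu, hus⟩ := ih
    rcases total_of le a u with h | h
    · refine ⟨a, by simp, fun x hx => ?_⟩
      rcases Finset.mem_cons.1 hx with rfl | hx
      exacts [refl_of le _, trans_of le h (hus x hx)]
    · refine ⟨u, by simp [hu], fun x hx => ?_⟩
      rcases Finset.mem_cons.1 hx with rfl | hx
      exacts [h, hus x hx]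

theorem ReachIn.mem_wReach {G : SimpleGraph V} {le : V → V → Prop} {r : ℕ} {u v : V}
    (h : ReachIn G {x | le u x} r u v) : u ∈ WReach G le r v := by
  classical
  refine ⟨h.right_mem, ?_⟩
  obtain ⟨p, hp, hA⟩ := h
  exact ⟨p.bypass, p.bypass_isPath, p.length_bypass_le_length.trans hp,
    fun x hx hxu _ => ⟨hA x (p.support_bypass_subset_support hx), hxu.symm⟩⟩

theorem exists_isLinearOrder_ncard_wReach_le [Fintype V] (G : SimpleGraph V) (r : ℕ) :
    ∃ le : V → V → Prop, IsLinearOrder V le ∧ ∀ v, (WReach G le r v).ncard ≤ wcol G r := by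
  refine Nat.sInf_mem (s := {k | ∃ le : V → V → Prop, IsLinearOrder V le ∧
    ∀ v, (WReach G le r v).ncard ≤ k}) ⟨Nat.card V, _,
    Function.Injective.isLinearOrder_onFun (· ≤ ·) (Fintype.equivFin V).injective, fun v => ?_⟩
  rw [← Set.ncard_univ]
  exact Set.ncard_le_ncard (Set.subset_univ _)

/-- The order of a clique that is a shallow minor is a lower bound for a weak coloring number. -/
theorem IsDepthMinor.le_wcol [Fintype V] {G : SimpleGraph V} {r m : ℕ}
    (h : IsDepthMinor r (⊤ : SimpleGraph (Fin m)) G) : m ≤ wcol G (4 * r + 1) := by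
  classical
  obtain ⟨φ, hr, hd, he⟩ := h
  simp only [hasRadiusLE_induce_iff] at hr
  choose c hc hcr using hr
  obtain ⟨le, hle, hwcol⟩ := exists_isLinearOrder_ncard_wReach_le G (4 * r + 1)
  rcases Nat.eq_zero_or_pos m with rfl | hm
  · exact Nat.zero_le _
  have hmin : ∀ a, ∃ u ∈ φ a, ∀ x ∈ φ a, le u x := fun a => by
    simpa using Finset.exists_le_of_isLinearOrder le (s := (φ a).toFinset) ⟨c a, by simp [hc a]⟩
  choose u hu hule using hmin
  have huinj : Function.Injective u := fun a b hab => by_contra fun hne =>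
    Set.disjoint_left.1 (hd hne) (hu a) (hab ▸ hu b)
  have hswap : IsLinearOrder V (Function.swap le) :=
    { refl := refl_of le
      trans := fun _ _ _ h h' => trans_of le h' h
      antisymm := fun _ _ h h' => antisymm_of le h' h
      total := fun a b => total_of le b a }
  obtain ⟨b, hb⟩ : ∃ b, ∀ a, le (u a) (u b) := by
    obtain ⟨y, hy, hmax⟩ := Finset.exists_le_of_isLinearOrder (Function.swap le)
      (s := Finset.univ.image u) ⟨u ⟨0, hm⟩, by simp⟩
    obtain ⟨b, -, rfl⟩ := Finset.mem_image.1 hy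
    exact ⟨b, fun a => hmax _ (by simp)⟩
  have hreach : ∀ a, ReachIn G {x | le (u a) x} (4 * r + 1) (u a) (u b) := by
    intro a
    by_cases hab : a = b
    · subst hab
      exact .refl (refl_of le _)
    have ha : φ a ⊆ {x | le (u a) x} := hule a
    have hb : φ b ⊆ {x | le (u a) x} := fun x hx => trans_of le (hb a) (hule b x hx)
    obtain ⟨x, hx, y, hy, hxy⟩ := he a b ((top_adj a b).2 hab)
    have h1 := (hcr a _ (hu a)).symm.trans (hcr a x hx)
    have h2 := (hcr b y hy).symm.trans (hcr b _ (hu b))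
    exact (((h1.mono le_rfl ha).trans (.of_adj hxy (ha hx) (hb hy))).trans
      (h2.mono le_rfl hb)).mono (by lia) subset_rfl
  calc m = (Set.range u).ncard := by
        rw [← Set.image_univ, Set.ncard_image_of_injective _ huinj, Set.ncard_univ, Nat.card_fin]
    _ ≤ (WReach G le (4 * r + 1) (u b)).ncard := by
        refine Set.ncard_le_ncard ?_
        rintro _ ⟨a, rfl⟩
        exact (hreach a).mem_wReach
    _ ≤ wcol G (4 * r + 1) := hwcol _

theorem nowhereDense_of_wcol_le {C : Set FGraph}
    (h : ∀ (r : ℕ) (ε : ℝ), 0 < ε → ∃ w : ℝ, ∀ G ∈ C, ∀ H : FGraph, IsSubgraphOf H G →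
      (wcol H.G r : ℝ) ≤ w * (Fintype.card H.V : ℝ) ^ ε) : NowhereDense C := by
  intro r
  obtain ⟨w, hw⟩ := h (4 * r + 1) (1 / 4) (by norm_num)
  obtain ⟨m, hm⟩ := exists_nat_gt (max 1 (w ^ 4 * (2 * (r + 1))))
  obtain ⟨hm1, hm2⟩ := max_lt_iff.1 hm
  refine ⟨m, fun G hG hminor => ?_⟩
  obtain ⟨U, hU, hminorU⟩ := hminor.exists_small_induce
  have h1 : (m : ℝ) ≤ w * (U.card : ℝ) ^ (1 / 4 : ℝ) := by
    have h2 := hw G hG ⟨(U : Set G.V), G.G.induce (U : Set G.V)⟩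
      ⟨Subtype.val, Subtype.val_injective, fun _ _ hab => hab⟩
    have h3 : (m : ℝ) ≤ wcol (G.G.induce (U : Set G.V)) (4 * r + 1) := by
      exact_mod_cast hminorU.le_wcol
    simpa using h3.trans h2
  have h2 : (m : ℝ) ^ 4 ≤ w ^ 4 * U.card := by
    refine (pow_le_pow_left₀ (by positivity) h1 4).trans_eq ?_
    rw [mul_pow, ← Real.rpow_natCast (_ ^ (1 / 4 : ℝ)), ← Real.rpow_mul (by positivity)]
    norm_num
  have h3 : (U.card : ℝ) ≤ m * (m * (2 * (r + 1))) := by exact_mod_cast hU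
  have h4 : (m : ℝ) ^ 4 ≤ w ^ 4 * (2 * (r + 1)) * m ^ 2 := by
    refine (h2.trans (mul_le_mul_of_nonneg_left h3 (by positivity))).trans_eq ?_
    ring
  have h5 : w ^ 4 * (2 * (r + 1)) * (m : ℝ) ^ 2 < m * m ^ 2 := by gcongr
  have h6 : (m : ℝ) * m ^ 2 ≤ m ^ 4 := by
    rw [← pow_succ']
    exact pow_le_pow_right₀ hm1.le (by norm_num)
  linarith

/-- A class is nowhere dense iff for every `r` and `ε > 0` there is
`w` with `wcol_r(H) ≤ w · |V(H)|^ε` for every subgraph `H` of a member. -/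
theorem stmt10 (C : Set FGraph) :
    NowhereDense C ↔
      ∀ (r : ℕ) (ε : ℝ), 0 < ε → ∃ w : ℝ, ∀ G ∈ C, ∀ H : FGraph,
        IsSubgraphOf H G →
          (wcol H.G r : ℝ) ≤ w * (Fintype.card H.V : ℝ) ^ ε := by
  exact ⟨fun hC r _ hε => hC.exists_wcol_le r hε, nowhereDense_of_wcol_le⟩
end

section
/- Let G be a graph, r ∈ ℕ, and let ℓ = wcol_{2r}(G). Then splitter wins the simple ℓ-round radius-r splitter game on G. -/
open SimpleGraph

variable {V : Type} {W : Type}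

lemma self_mem_wReach (G : SimpleGraph V) (le : V → V → Prop) [Std.Refl le] (r : ℕ) (v : V) :
    v ∈ WReach G le r v :=
  ⟨refl_of le v, .nil, .nil, Nat.zero_le _, by simp⟩

/-- Weak reachability is preserved by injective homomorphisms that respect the order. -/
lemma map_mem_wReach {H : SimpleGraph W} {G : SimpleGraph V} (f : H →g G)
    (hf : Function.Injective f) (le : V → V → Prop) (r : ℕ) {u v : W}
    (h : u ∈ WReach H (Order.Preimage f le) r v) : f u ∈ WReach G le r (f v) := by
  obtain ⟨huv, p, hp, hlen, hsup⟩ := h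
  refine ⟨huv, p.map f, hp.map hf, by simpa using hlen, fun x hx hxu hxv => ?_⟩
  rw [Walk.support_map, List.mem_map] at hx
  obtain ⟨y, hy, rfl⟩ := hx
  obtain ⟨h₁, h₂⟩ := hsup y hy (fun h => hxu (h ▸ rfl)) (fun h => hxv (h ▸ rfl))
  exact ⟨h₁, hf.ne h₂⟩

/-- In a graph of radius at most `r`, the least vertex is weakly `2r`-reachable from
every vertex. -/
lemma mem_wReach_of_forall_le {G : SimpleGraph V} {r : ℕ} (hG : hasRadiusLE G r)
    {le : V → V → Prop} {w : V} (hw : ∀ v, le w v) (v : V) : w ∈ WReach G le (2 * r) v := by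
  classical
  obtain ⟨c, hc⟩ := hG
  obtain ⟨p, hp⟩ := hc w
  obtain ⟨q, hq⟩ := hc v
  refine ⟨hw v, (p.reverse.append q).bypass, Walk.bypass_isPath _, ?_,
    fun x _ hx _ => ⟨hw x, hx.symm⟩⟩
  refine (Walk.length_bypass_le_length _).trans ?_
  rw [Walk.length_append, Walk.length_reverse]
  omega

lemma exists_forall_rel [Finite V] [Nonempty V] (le : V → V → Prop) [IsLinearOrder V le] :
    ∃ w, ∀ v, le w v := by
  let _ : LinearOrder V :=
    { le := le
      le_refl := refl_of le
      le_trans := fun _ _ _ => trans_of le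
      le_antisymm := fun _ _ => antisymm_of le
      le_total := total_of le
      toDecidableLE := Classical.decRel le }
  exact Finite.exists_min id

lemma splitterWins_of_ncard_wReach_le (r ℓ : ℕ) :
    ∀ (V : Type) [Finite V] (G : SimpleGraph V) (le : V → V → Prop) [IsLinearOrder V le],
      (∀ v, (WReach G le (2 * r) v).ncard ≤ ℓ) → SplitterWins r ℓ V G := by
  induction ℓ with
  | zero =>
    intro V _ G le _ h
    refine ⟨fun v => ?_⟩
    have hv := self_mem_wReach G le (2 * r) v
    rw [(Set.ncard_eq_zero (Set.toFinite _)).1 (Nat.le_zero.1 (h v))] at hv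
    exact hv
  | succ ℓ ih =>
    intro V _ G le _ h C hC
    obtain ⟨c, _⟩ := id hC
    have : Nonempty C.verts := ⟨c⟩
    have : IsLinearOrder C.verts (Order.Preimage C.hom le) :=
      (RelEmbedding.preimage ⟨C.hom, C.hom_injective⟩ le).isLinearOrder
    obtain ⟨w, hw⟩ := exists_forall_rel (Order.Preimage C.hom le)
    refine ⟨w, w.2, ?_⟩
    set D := C.deleteVerts {(w : V)}
    have : IsLinearOrder D.verts (Order.Preimage D.hom le) :=
      (RelEmbedding.preimage ⟨D.hom, D.hom_injective⟩ le).isLinearOrder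
    refine ih _ _ (Order.Preimage D.hom le) fun v => Nat.le_of_lt_succ (lt_of_lt_of_le ?_ (h v))
    rw [← Set.ncard_image_of_injective _ D.hom_injective]
    refine Set.ncard_lt_ncard ?_ (Set.toFinite _)
    refine (Set.ssubset_iff_of_subset ?_).2 ⟨w, ?_, ?_⟩
    · rintro _ ⟨u, hu, rfl⟩
      exact map_mem_wReach D.hom D.hom_injective le _ hu
    · exact map_mem_wReach C.hom C.hom_injective le _
        (mem_wReach_of_forall_le hC hw ⟨v, v.2.1⟩)
    · rintro ⟨u, -, hu⟩
      exact u.2.2 hu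

/-- Splitter wins the simple `wcol_{2r}(G)`-round radius-`r`
splitter game on `G`. -/
theorem stmt11 {V : Type} [Fintype V] (G : SimpleGraph V) (r : ℕ) :
    SplitterWins r (wcol G (2 * r)) V G := by
  have hne : {k | ∃ le : V → V → Prop, IsLinearOrder V le ∧
      ∀ v, (WReach G le (2 * r) v).ncard ≤ k}.Nonempty := by
    obtain ⟨f⟩ : Nonempty (V ≃ Fin (Fintype.card V)) := ⟨Fintype.equivFin V⟩
    exact ⟨Nat.card V, Order.Preimage f (· ≤ ·),
      (RelEmbedding.preimage f.toEmbedding (· ≤ ·)).isLinearOrder, fun _ => Set.ncard_le_card _⟩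
  obtain ⟨le, hle, h⟩ := Nat.sInf_mem hne
  exact splitterWins_of_ncard_wReach_le r _ V G le h
end

section
/- Let G be a graph, r ∈ ℕ, and let π be a linear order of V(G) witnessing wcol_{2r}(G) ≤ s. For v ∈ V(G) let m(v) be the π-minimum vertex of N_r(v), and for u ∈ V(G) let X_{2r}[G,π,u] = {w ∈ V(G) : u ∈ WReach_{2r}[G,π,w]}. Then 𝒳 = {X_{2r}[G,π,m(v)] : v ∈ V(G)} is an r-neighborhood cover of G of radius at most 2r in which every vertex belongs to at most s clusters. -/
open SimpleGraph

variable {V : Type} {W : Type}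

theorem mem_ball_of_mem_support {V : Type} {G : SimpleGraph V} {r : ℕ} {v u x : V}
    (p : G.Walk v u) (hp : p.length ≤ r) (hx : x ∈ p.support) : x ∈ ball G r v := by
  classical
  exact ⟨p.takeUntil x hx, (p.length_takeUntil_le_length hx).trans hp⟩

/-- A short walk all of whose vertices are at least its start `u` stays in the cluster of `u`. -/
theorem mem_XCluster_of_walk {V : Type} {G : SimpleGraph V} {le : V → V → Prop} {r : ℕ} {u w : V}
    (p : G.Walk u w) (hp : p.length ≤ r) (h : ∀ x ∈ p.support, le u x) :
    w ∈ XCluster G le r u := by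
  classical
  exact ⟨h w p.end_mem_support, p.bypass, p.bypass_isPath,
    p.length_bypass_le_length.trans hp,
    fun x hx hxu _ => ⟨h x (p.support_bypass_subset_support hx), hxu.symm⟩⟩

theorem hasRadiusLE_XCluster {V : Type} {G : SimpleGraph V} {le : V → V → Prop} {r : ℕ} {u : V}
    (hrefl : le u u) : hasRadiusLE (G.induce (XCluster G le r u)) r := by
  classical
  have hu : u ∈ XCluster G le r u := mem_XCluster_of_walk .nil (by simp) (by simpa using hrefl)
  refine ⟨⟨u, hu⟩, ?_⟩
  rintro ⟨w, hw⟩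
  obtain ⟨huw, p, -, hpl, hp⟩ := hw
  have hle : ∀ x ∈ p.support, le u x := fun x hx => by
    by_cases hxu : x = u
    · exact hxu ▸ hrefl
    by_cases hxw : x = w
    · exact hxw ▸ huw
    exact (hp x hx hxu hxw).1
  have hsub : ∀ x ∈ p.support, x ∈ XCluster G le r u := fun x hx =>
    mem_XCluster_of_walk (p.takeUntil x hx) ((p.length_takeUntil_le_length hx).trans hpl)
      fun y hy => hle y (p.support_takeUntil_subset_support hx hy)
  refine ⟨p.induce _ hsub, ?_⟩
  rw [← Walk.length_map (Embedding.induce _).toHom, Walk.map_induce]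
  exact hpl

theorem ball_subset_XCluster {V : Type} {G : SimpleGraph V} {le : V → V → Prop} {r : ℕ} {v u : V}
    (hu : u ∈ ball G r v) (hmin : ∀ x ∈ ball G r v, le u x) :
    ball G r v ⊆ XCluster G le (2 * r) u := by
  rintro w ⟨q, hq⟩
  obtain ⟨p, hp⟩ := hu
  refine mem_XCluster_of_walk (p.reverse.append q) (by simp; omega) fun x hx => hmin x ?_
  rw [Walk.mem_support_append_iff, Walk.support_reverse, List.mem_reverse] at hx
  exact hx.elim (mem_ball_of_mem_support p hp) (mem_ball_of_mem_support q hq)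

/-- If `π` witnesses `wcol_{2r}(G) ≤ s` and `m v` is the `π`-minimum
of `N_r(v)`, then the clusters `X_{2r}[G,π,m v]` form an `r`-neighborhood cover of
radius at most `2r` and degree at most `s`. -/
theorem stmt13 {V : Type} [Fintype V] (G : SimpleGraph V) (r s : ℕ)
    (le : V → V → Prop) (hle : IsLinearOrder V le)
    (hwit : ∀ v, (WReach G le (2 * r) v).ncard ≤ s)
    (m : V → V)
    (hm : ∀ v, m v ∈ ball G r v ∧ ∀ u ∈ ball G r v, le (m v) u) :
    IsNbhdCover G r (2 * r) (Set.range fun v => XCluster G le (2 * r) (m v)) ∧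
      ∀ v : V,
        ({Y ∈ Set.range (fun v' => XCluster G le (2 * r) (m v')) | v ∈ Y}).ncard ≤ s := by
  refine ⟨⟨?_, fun v => ⟨_, ⟨v, rfl⟩, ball_subset_XCluster (hm v).1 (hm v).2⟩⟩, fun v => ?_⟩
  · rintro _ ⟨v, rfl⟩
    exact hasRadiusLE_XCluster (refl_of le _)
  · have hsub : {Y ∈ Set.range (fun v' => XCluster G le (2 * r) (m v')) | v ∈ Y} ⊆
        XCluster G le (2 * r) '' WReach G le (2 * r) v := by
      rintro _ ⟨⟨v', rfl⟩, hv⟩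
      exact ⟨m v', hv, rfl⟩
    exact (Set.ncard_le_ncard hsub (Set.toFinite _)).trans
      ((Set.ncard_image_le (Set.toFinite _)).trans (hwit v))
end

section
/- Let G be a graph and r ∈ ℕ. Then there exist N ≤ wcol_{4r+1}(G) induced subgraphs H_1, …, H_N of G such that (1) for every v ∈ V(G) there is some 1 ≤ i ≤ N with N_r(v) ⊆ V(H_i), and (2) every connected component of every H_i has radius at most 2r. -/
open SimpleGraph

variable {V : Type} {W : Type}

lemma wellFounded_strict {α : Type*} [Finite α] {le : α → α → Prop} (hle : IsLinearOrder α le) :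
    WellFounded fun a b => le a b ∧ a ≠ b := by
  have : IsTrans α fun a b => le a b ∧ a ≠ b :=
    ⟨fun a b c hab hbc => ⟨hle.trans _ _ _ hab.1 hbc.1, fun hac =>
      hab.2 (hle.antisymm _ _ hab.1 (hac ▸ hbc.1))⟩⟩
  have : Std.Irrefl fun a b => le a b ∧ a ≠ b := ⟨fun a h => h.2 rfl⟩
  exact Finite.wellFounded_of_trans_of_irrefl _

/-- Weak reachability may be witnessed by walks instead of paths. -/
lemma mem_WReach_iff {V : Type} {G : SimpleGraph V} {le : V → V → Prop} (hle : IsLinearOrder V le)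
    {r : ℕ} {u v : V} :
    u ∈ WReach G le r v ↔ ∃ p : G.Walk u v, p.length ≤ r ∧ ∀ x ∈ p.support, le u x := by
  classical
  constructor
  · rintro ⟨huv, p, -, hlen, hp⟩
    refine ⟨p, hlen, fun x hx => ?_⟩
    by_cases hxu : x = u
    · exact hxu ▸ hle.refl x
    · by_cases hxv : x = v
      · exact hxv ▸ huv
      · exact (hp x hx hxu hxv).1
  · rintro ⟨p, hlen, hp⟩
    exact ⟨hp v p.end_mem_support, p.bypass, p.bypass_isPath,
      p.length_bypass_le_length.trans hlen,
      fun x hx hxu _ => ⟨hp x (p.support_bypass_subset_support hx), hxu.symm⟩⟩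

lemma self_mem_XCluster {V : Type} (G : SimpleGraph V) {le : V → V → Prop}
    (hle : IsLinearOrder V le) (r : ℕ) (u : V) : u ∈ XCluster G le r u :=
  (mem_WReach_iff hle).2 ⟨.nil, by simp, by simpa using hle.refl u⟩

/-- Every vertex of the cluster of `u` is reached from `u` by a short walk inside the cluster. -/
lemma exists_walk_in_XCluster {V : Type} {G : SimpleGraph V} {le : V → V → Prop}
    (hle : IsLinearOrder V le) {r : ℕ} {u w : V} (hw : w ∈ XCluster G le r u) :
    ∃ p : G.Walk u w, p.length ≤ r ∧ ∀ x ∈ p.support, x ∈ XCluster G le r u := by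
  classical
  obtain ⟨p, hlen, hp⟩ := (mem_WReach_iff hle).1 hw
  refine ⟨p, hlen, fun x hx => (mem_WReach_iff hle).2 ⟨p.takeUntil x hx, ?_, fun y hy => ?_⟩⟩
  · exact (p.length_takeUntil_le_length hx).trans hlen
  · exact hp y (p.support_takeUntil_subset_support hx hy)

/-- Every `r`-ball is contained in a cluster of weak `2r`-reachability. -/
lemma exists_ball_subset_XCluster {V : Type} [Finite V] (G : SimpleGraph V) {le : V → V → Prop}
    (hle : IsLinearOrder V le) (r : ℕ) (v : V) :
    ∃ u, ball G r v ⊆ XCluster G le (2 * r) u := by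
  classical
  obtain ⟨u, ⟨q, hq⟩, hmin⟩ := (wellFounded_strict hle).has_min (ball G r v) ⟨v, .nil, by simp⟩
  have hlow : ∀ x ∈ ball G r v, le u x := fun x hx => by
    rcases hle.total u x with h | h
    · exact h
    · by_cases hxu : x = u
      · exact hxu ▸ hle.refl x
      · exact absurd ⟨h, hxu⟩ (hmin x hx)
  have hball : ∀ {z : V} (p : G.Walk v z), p.length ≤ r → ∀ x ∈ p.support, x ∈ ball G r v :=
    fun p hp x hx => ⟨p.takeUntil x hx, (p.length_takeUntil_le_length hx).trans hp⟩
  exact ⟨u, fun w ⟨p, hp⟩ => (mem_WReach_iff hle).2 ⟨q.reverse.append p, by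
    rw [Walk.length_append, Walk.length_reverse]; omega, fun x hx => by
    rw [Walk.mem_support_append_iff, Walk.support_reverse, List.mem_reverse] at hx
    exact hlow x (hx.elim (hball q hq x) (hball p hp x))⟩⟩

/-- If two clusters are joined by an edge, then the smaller center is weakly reachable
from the other one. -/
lemma center_mem_WReach_of_adj {V : Type} {G : SimpleGraph V} {le : V → V → Prop}
    (hle : IsLinearOrder V le) {r : ℕ} {u u' w w' : V} (hw : w ∈ XCluster G le r u)
    (hw' : w' ∈ XCluster G le r u') (h : G.Adj w w') (huu' : le u u') :
    u ∈ WReach G le (2 * r + 1) u' := by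
  obtain ⟨p, hp, hpu⟩ := (mem_WReach_iff hle).1 hw
  obtain ⟨q, hq, hqu⟩ := (mem_WReach_iff hle).1 hw'
  refine (mem_WReach_iff hle).2 ⟨p.append (.cons h q.reverse), by
    rw [Walk.length_append, Walk.length_cons, Walk.length_reverse]; omega, fun x hx => ?_⟩
  rw [Walk.mem_support_append_iff, Walk.support_cons, List.mem_cons, Walk.support_reverse,
    List.mem_reverse] at hx
  rcases hx with hx | rfl | hx
  · exact hpu x hx
  · exact hpu x p.end_mem_support
  · exact hle.trans _ _ _ huu' (hqu x hx)

/-- Greedy coloring along a well-founded relation in which every element has fewer than `k`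
predecessors. -/
lemma exists_greedy_coloring {α : Type*} [Finite α] {R : α → α → Prop} (hR : WellFounded R)
    {k : ℕ} (hk : ∀ v, {u | R u v}.ncard < k) :
    ∃ c : α → Fin k, ∀ u v, R u v → c u ≠ c v := by
  have step : ∀ v (f : ∀ u, R u v → Fin k), ∃ i : Fin k, ∀ u (h : R u v), f u h ≠ i := by
    intro v f
    by_contra! hcon
    choose g hg hgi using hcon
    have hinj : Function.Injective g := fun i j hij => by
      rw [← hgi i, ← hgi j]
      congr 1
    have := Set.ncard_le_ncard (Set.range_subset_iff.2 hg : Set.range g ⊆ {u | R u v})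
    rw [Set.ncard_range_of_injective hinj, Nat.card_fin] at this
    exact absurd (hk v) this.not_gt
  choose F hF using step
  refine ⟨hR.fix F, fun u v huv => ?_⟩
  rw [hR.fix_eq F v]
  exact hF v (fun u _ => hR.fix F u) u huv

lemma exists_order_WReach_ncard_le_wcol {V : Type} [Finite V] (G : SimpleGraph V) (r : ℕ) :
    ∃ le : V → V → Prop, IsLinearOrder V le ∧ ∀ v, (WReach G le r v).ncard ≤ wcol G r := by
  refine Nat.sInf_mem (s := {k | ∃ le : V → V → Prop, IsLinearOrder V le ∧
    ∀ v, (WReach G le r v).ncard ≤ k}) ?_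
  let _ := IsWellOrder.linearOrder (WellOrderingRel (α := V))
  exact ⟨Nat.card V, (· ≤ ·), inferInstance, fun v => Set.ncard_le_card _⟩

/-- If a vertex `u` of a component of `G.induce S` lies in a set `X ⊆ S` whose vertices are reached
from `u` by walks of length at most `d` inside `X`, and no edge inside `S` leaves `X`,
then the component has radius at most `d`. -/
lemma hasRadiusLE_component_of_closed {V : Type} {G : SimpleGraph V} {S X : Set V} {d : ℕ} {u : V}
    (hXS : X ⊆ S) (hu : u ∈ X)
    (hwalk : ∀ w ∈ X, ∃ p : G.Walk u w, p.length ≤ d ∧ ∀ x ∈ p.support, x ∈ X)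
    (hclosed : ∀ w ∈ X, ∀ w' ∈ S, G.Adj w w' → w' ∈ X) :
    hasRadiusLE ((G.induce S).induce
      ((G.induce S).connectedComponentMk ⟨u, hXS hu⟩).supp) d := by
  have hmem : ∀ {a b : S}, (G.induce S).Walk a b → a.1 ∈ X → b.1 ∈ X := by
    intro a b p
    induction p with
    | nil => exact id
    | cons h _ ih => exact fun ha => ih (hclosed _ ha _ (Subtype.prop _) h)
  refine ⟨⟨⟨u, hXS hu⟩, rfl⟩, ?_⟩
  rintro ⟨⟨w, hwS⟩, hw⟩
  obtain ⟨q⟩ := (ConnectedComponent.exact hw).symm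
  obtain ⟨p, hp, hpX⟩ := hwalk w (hmem q hu)
  let p' := p.induce S fun x hx => hXS (hpX x hx)
  have hp' : ∀ x ∈ p'.support,
      x ∈ ((G.induce S).connectedComponentMk ⟨u, hXS hu⟩).supp := by
    classical
    exact fun x hx => ConnectedComponent.sound ⟨(p'.takeUntil x hx).reverse⟩
  refine ⟨p'.induce _ hp', ?_⟩
  have h1 := congrArg Walk.length (Walk.map_induce p' hp')
  have h2 := congrArg Walk.length (Walk.map_induce p fun x hx => hXS (hpX x hx))
  rw [Walk.length_map] at h1 h2
  exact (h1.trans h2).trans_le hp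

/-- There are `N ≤ wcol_{4r+1}(G)` induced subgraphs of `G` such that
every `r`-ball is contained in one of them and every connected component of each of
them has radius at most `2r`. -/
theorem stmt14 {V : Type} [Fintype V] (G : SimpleGraph V) (r : ℕ) :
    ∃ N : ℕ, N ≤ wcol G (4 * r + 1) ∧ ∃ H : Fin N → Set V,
      (∀ v : V, ∃ i : Fin N, ball G r v ⊆ H i) ∧
      (∀ i : Fin N, ∀ c : (G.induce (H i)).ConnectedComponent,
        hasRadiusLE ((G.induce (H i)).induce c.supp) (2 * r)) := by
  obtain ⟨le, hle, hcard⟩ := exists_order_WReach_ncard_le_wcol G (4 * r + 1)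
  have hR : WellFounded fun a b => a ∈ WReach G le (4 * r + 1) b ∧ a ≠ b :=
    Subrelation.wf (fun h => ⟨h.1.1, h.2⟩) (wellFounded_strict hle)
  obtain ⟨c, hc⟩ := exists_greedy_coloring hR fun v => by
    refine (Set.ncard_lt_ncard (t := WReach G le (4 * r + 1) v) ?_).trans_le (hcard v)
    exact ⟨fun u hu => hu.1, fun h => (h (self_mem_XCluster G hle _ v)).2 rfl⟩
  have hsame : ∀ {u u' w w'}, c u = c u' → w ∈ XCluster G le (2 * r) u →
      w' ∈ XCluster G le (2 * r) u' → G.Adj w w' → u = u' := by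
    intro u u' w w' hcu hw hw' h
    by_contra hne
    have hlen : 2 * (2 * r) + 1 = 4 * r + 1 := by ring
    rcases hle.total u u' with hl | hl
    · exact hc u u' ⟨hlen ▸ center_mem_WReach_of_adj hle hw hw' h hl, hne⟩ hcu
    · exact hc u' u ⟨hlen ▸ center_mem_WReach_of_adj hle hw' hw h.symm hl, Ne.symm hne⟩ hcu.symm
  refine ⟨_, le_rfl, fun i => {w | ∃ u, c u = i ∧ w ∈ XCluster G le (2 * r) u},
    fun v => ?_, fun i C => ?_⟩
  · obtain ⟨u, hu⟩ := exists_ball_subset_XCluster G hle r v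
    exact ⟨c u, fun w hw => ⟨u, rfl, hu hw⟩⟩
  · induction C using ConnectedComponent.ind with | _ w
    obtain ⟨w, hw⟩ := w
    obtain ⟨u, rfl, hwu⟩ := id hw
    have hXS : XCluster G le (2 * r) u ⊆ {w | ∃ u', c u' = c u ∧ w ∈ XCluster G le (2 * r) u'} :=
      fun x hx => ⟨u, rfl, hx⟩
    have huX := self_mem_XCluster G hle (2 * r) u
    obtain ⟨p, -, hp⟩ := exists_walk_in_XCluster hle hwu
    rw [← ConnectedComponent.sound ⟨p.induce _ fun x hx => hXS (hp x hx)⟩]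
    refine hasRadiusLE_component_of_closed hXS huX
      (fun w hw => exists_walk_in_XCluster hle hw) ?_
    rintro x hx x' ⟨u', hcu', hx'⟩ hadj
    rwa [hsame hcu'.symm hx hx' hadj]
end

section
/- Let G be a graph, r ∈ ℕ, ε > 0, and suppose 𝒞 is uniformly quasi-wide with numbers s = s(4r) and N = N(4r, ⌊1/ε⌋ + s + 1), and G ∈ 𝒞. Let A ⊆ V(G) and let X ⊆ V(G) be a set with |X| > N such that |N_r^{G−X}(v) ∩ A| ≤ ε·|A| for all v ∈ V(G) \ X. Then there exists Z ⊆ V(G) with |Z| < |X| such that |N_r^{G−Z}(v) ∩ A| ≤ ε·|A| for all v ∈ V(G) \ Z. -/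
open SimpleGraph

variable {V : Type} {W : Type}

theorem ballAvoiding_mono (G : SimpleGraph V) {S T : Set V} (h : S ⊆ T) (r : ℕ) (v : V) :
    ballAvoiding G T r v ⊆ ballAvoiding G S r v := by
  rintro u ⟨p, hp, hT⟩
  exact ⟨p, hp, fun x hx hxS => hT x hx (h hxS)⟩

theorem mem_ballAvoiding_comm (G : SimpleGraph V) (S : Set V) (r : ℕ) (u v : V) :
    u ∈ ballAvoiding G S r v ↔ v ∈ ballAvoiding G S r u := by
  constructor <;> rintro ⟨p, hp, hS⟩ <;>
    exact ⟨p.reverse, by simpa using hp, by simpa using hS⟩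

theorem mem_ballAvoiding_trans {G : SimpleGraph V} {S : Set V} {k l : ℕ} {u v w : V}
    (huv : v ∈ ballAvoiding G S k u) (hvw : w ∈ ballAvoiding G S l v) :
    w ∈ ballAvoiding G S (k + l) u := by
  obtain ⟨p, hp, hpS⟩ := huv
  obtain ⟨q, hq, hqS⟩ := hvw
  refine ⟨p.append q, by rw [Walk.length_append]; omega, fun x hx => ?_⟩
  rcases (Walk.mem_support_append_iff ..).1 hx with hx | hx
  exacts [hpS x hx, hqS x hx]

/-- If no vertex of `T \ S` is in the ball of `v` in `G - S`, then the ball avoids `T`. -/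
theorem ballAvoiding_subset_of_disjoint {G : SimpleGraph V} {S T : Set V} {r : ℕ} {v : V}
    (h : ∀ x ∈ T, x ∉ S → x ∉ ballAvoiding G S r v) :
    ballAvoiding G S r v ⊆ ballAvoiding G T r v := by
  classical
  rintro u ⟨p, hp, hS⟩
  refine ⟨p, hp, fun x hx hxT => h x hxT (hS x hx) ⟨p.takeUntil x hx, ?_, fun y hy => ?_⟩⟩
  · exact (p.length_takeUntil_le_length hx).trans hp
  · exact hS y (p.support_takeUntil_subset_support hx hy)

theorem DistIndepIn.pairwiseDisjoint_ballAvoiding {G : SimpleGraph V} {S B : Set V} {k r : ℕ}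
    (hB : DistIndepIn G S k B) (h : r + r ≤ k) :
    B.PairwiseDisjoint (ballAvoiding G S r) := by
  intro b hb c hc hbc
  refine Set.disjoint_left.2 fun x hx hx' => ?_
  obtain ⟨p, hp, hpS⟩ := mem_ballAvoiding_trans hx ((mem_ballAvoiding_comm ..).1 hx')
  have := hB b hb c hc hbc p hpS
  omega

/-- Among pairwise disjoint sets, at most `1 / ε` contain more than an `ε`-fraction of `A`. -/
theorem ncard_large_inter_le {α ι : Type*} [Finite α] [Finite ι] (A : Set α) (B : Set ι)
    (f : ι → Set α) (hf : B.PairwiseDisjoint f) {ε : ℝ} (hε : 0 < ε) :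
    {b ∈ B | ε * (A.ncard : ℝ) < ((f b ∩ A).ncard : ℝ)}.ncard ≤ ⌊1 / ε⌋₊ := by
  classical
  have := Fintype.ofFinite α
  have := Fintype.ofFinite ι
  set D : Set ι := {b ∈ B | ε * (A.ncard : ℝ) < ((f b ∩ A).ncard : ℝ)}
  rcases D.eq_empty_or_nonempty with h0 | ⟨b, hb⟩
  · simp [h0]
  have hApos : (0 : ℝ) < A.ncard := by
    by_contra! hA
    have h1 : (f b ∩ A).ncard ≤ A.ncard := Set.ncard_le_ncard Set.inter_subset_right
    have h2 : (A.ncard : ℝ) = 0 := le_antisymm hA (Nat.cast_nonneg _)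
    have h3 : ((f b ∩ A).ncard : ℝ) ≤ A.ncard := by exact_mod_cast h1
    have h4 := hb.2
    rw [h2] at h3 h4
    linarith
  have hsum : ∑ b ∈ D.toFinset, (f b ∩ A).ncard ≤ A.ncard := by
    simp_rw [Set.ncard_eq_toFinset_card']
    rw [← Finset.card_biUnion]
    · refine Finset.card_le_card fun x hx => ?_
      simp only [Finset.mem_biUnion, Set.mem_toFinset] at hx ⊢
      obtain ⟨_, _, hx⟩ := hx
      exact hx.2
    · intro b hb c hc hbc
      rw [Function.onFun, Set.disjoint_toFinset]
      exact (hf (Set.mem_toFinset.1 hb).1 (Set.mem_toFinset.1 hc).1 hbc).mono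
        Set.inter_subset_left Set.inter_subset_left
  have hlow : (D.ncard : ℝ) * (ε * A.ncard) ≤ A.ncard := by
    calc (D.ncard : ℝ) * (ε * A.ncard) = ∑ _b ∈ D.toFinset, ε * (A.ncard : ℝ) := by
          rw [Finset.sum_const, nsmul_eq_mul, Set.ncard_eq_toFinset_card']
      _ ≤ ∑ b ∈ D.toFinset, ((f b ∩ A).ncard : ℝ) :=
          Finset.sum_le_sum fun b hb => (Set.mem_toFinset.1 hb).2.le
      _ ≤ A.ncard := by exact_mod_cast hsum
  refine Nat.le_floor ((le_div_iff₀ hε).2 ?_)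
  refine le_of_mul_le_mul_right ?_ hApos
  linarith

/-- The exchange step: given the uniform quasi-wideness property with
numbers `s = s(4r)` and `N = N(4r, ⌊1/ε⌋ + s + 1)`, any separator `X` with `|X| > N`
achieving small `r`-balls w.r.t. `A` can be replaced by a strictly smaller one. -/
theorem stmt17 (C : Set FGraph) (GG : FGraph) (hG : GG ∈ C)
    (r : ℕ) (ε : ℝ) (hε : 0 < ε) (s N : ℕ)
    (hUQW : ∀ G' ∈ C, ∀ A : Set G'.V, N ≤ A.ncard →
      ∃ S : Set G'.V, S.ncard ≤ s ∧
        ∃ B ⊆ A \ S, ⌊1 / ε⌋₊ + s + 1 ≤ B.ncard ∧ DistIndepIn G'.G S (4 * r) B)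
    (A X : Set GG.V) (hX : N < X.ncard)
    (hball : ∀ v : GG.V, v ∉ X →
      ((ballAvoiding GG.G X r v ∩ A).ncard : ℝ) ≤ ε * (A.ncard : ℝ)) :
    ∃ Z : Set GG.V, Z.ncard < X.ncard ∧
      ∀ v : GG.V, v ∉ Z →
        ((ballAvoiding GG.G Z r v ∩ A).ncard : ℝ) ≤ ε * (A.ncard : ℝ) := by
  obtain ⟨S, hS, B, hBX, hB, hind⟩ := hUQW GG hG X hX.le
  have hbad := ncard_large_inter_le A B _
    (hind.pairwiseDisjoint_ballAvoiding (r := r + r) (by omega)) hε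
  set D : Set GG.V := {b ∈ B | ε * (A.ncard : ℝ) <
    ((ballAvoiding GG.G S (r + r) b ∩ A).ncard : ℝ)}
  have hgood : s + 1 ≤ (B \ D).ncard := by
    have := Set.ncard_sdiff_add_ncard_of_subset (show D ⊆ B from fun _ h => h.1)
    omega
  have hSZ : S ⊆ X \ (B \ D) ∪ S := Set.subset_union_right
  refine ⟨X \ (B \ D) ∪ S, ?_, fun v hv => ?_⟩
  · have h1 := Set.ncard_union_le (X \ (B \ D)) S
    have h2 := Set.ncard_sdiff_add_ncard_of_subset
      (show B \ D ⊆ X from fun _ h => (hBX h.1).1)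
    omega
  by_cases h : ∃ b ∈ B \ D, b ∈ ballAvoiding GG.G (X \ (B \ D) ∪ S) r v
  · obtain ⟨b, hb, hbv⟩ := h
    have hle : ((ballAvoiding GG.G S (r + r) b ∩ A).ncard : ℝ) ≤ ε * A.ncard :=
      not_lt.1 fun hlt => hb.2 ⟨hb.1, hlt⟩
    refine le_trans (Nat.cast_le.2 (Set.ncard_le_ncard (Set.inter_subset_inter_left A ?_))) hle
    exact fun x hx => ballAvoiding_mono _ hSZ _ _
      (mem_ballAvoiding_trans ((mem_ballAvoiding_comm ..).1 hbv) hx)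
  · push Not at h
    have hout : ∀ x ∈ X, x ∉ X \ (B \ D) ∪ S →
        x ∉ ballAvoiding GG.G (X \ (B \ D) ∪ S) r v := fun x hxX hxZ =>
      h x (by_contra fun hx => hxZ (Or.inl ⟨hxX, hx⟩))
    have hvX : v ∉ X := fun hvX =>
      hout v hvX hv ⟨Walk.nil, Nat.zero_le _, by simpa using hv⟩
    exact le_trans (Nat.cast_le.2 (Set.ncard_le_ncard
      (Set.inter_subset_inter_left A (ballAvoiding_subset_of_disjoint hout)))) (hball v hvX)
end
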